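/- arXiv:2210.10006 — 2 statements merged into one kernel-verified Lean document; each statement's English description precedes it below -/
import Mathlib

section
/- Let n ≥ 2 and suppose (θ1,θ2) ∈ A ∪ B. Then the function w(x) = |x'|^{θ1}|x|^{θ2} is locally integrable on ℝ^n, so that dμ = w dx defines a Radon measure; moreover there exists a constant C = C(n,θ1,θ2) ≥ 1 such that for every R > 0 one has C^{-1} R^{n+θ1+θ2} ≤ μ(B_R(0)) ≤ C R^{n+θ1+θ2}. -/
open MeasureTheory Metric Set
open scoped ENNReal NNReal Topology

noncomputable section

/-- `ℝ^n` as a Euclidean space. -/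
abbrev En (n : ℕ) := EuclideanSpace ℝ (Fin n)

/-- `|x'|`: the Euclidean norm of the first `n-1` coordinates of `x`. -/
def normPrime (n : ℕ) (x : En n) : ℝ :=
  Real.sqrt (∑ i : Fin n, if (i : ℕ) + 1 < n then (x i) ^ 2 else 0)

/-- The anisotropic weight `w(x) = |x'|^θ1 * |x|^θ2`. -/
def weight (n : ℕ) (θ1 θ2 : ℝ) (x : En n) : ℝ :=
  normPrime n x ^ θ1 * ‖x‖ ^ θ2

/-- The measure `dμ = w dx` on `ℝ^n`. -/
def muW (n : ℕ) (θ1 θ2 : ℝ) : Measure (En n) :=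
  (volume : Measure (En n)).withDensity fun x => ENNReal.ofReal (weight n θ1 θ2 x)

/-- The index set `𝒜 = {(a,b) : a > -(n-1), b ≥ 0}`. -/
def setA (n : ℕ) : Set (ℝ × ℝ) := {p | -((n : ℝ) - 1) < p.1 ∧ 0 ≤ p.2}

/-- The index set `ℬ = {(a,b) : a > -(n-1), b < 0, a + b > -n}`. -/
def setB (n : ℕ) : Set (ℝ × ℝ) :=
  {p | -((n : ℝ) - 1) < p.1 ∧ p.2 < 0 ∧ -(n : ℝ) < p.1 + p.2}

/-- The index set `𝒞_q = {(a,b) : a < (n-1)(q-1), b ≤ 0}`. -/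
def setC (n : ℕ) (q : ℝ) : Set (ℝ × ℝ) := {p | p.1 < ((n : ℝ) - 1) * (q - 1) ∧ p.2 ≤ 0}

/-- The index set `𝒟_q = {(a,b) : a < (n-1)(q-1), b > 0, a+b < n(q-1)}`. -/
def setD (n : ℕ) (q : ℝ) : Set (ℝ × ℝ) :=
  {p | p.1 < ((n : ℝ) - 1) * (q - 1) ∧ 0 < p.2 ∧ p.1 + p.2 < (n : ℝ) * (q - 1)}

/-- The index set `ℱ = {(a,b) : a + b > -(n-1)}`. -/
def setF (n : ℕ) : Set (ℝ × ℝ) := {p | -((n : ℝ) - 1) < p.1 + p.2}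

lemma normPrime_nonneg (n : ℕ) (x : En n) : 0 ≤ normPrime n x := Real.sqrt_nonneg _

lemma continuous_normPrime (n : ℕ) : Continuous (normPrime n) := by
  unfold normPrime
  refine Real.continuous_sqrt.comp (continuous_finsetSum _ fun i _ => ?_)
  split_ifs <;> fun_prop

lemma measurable_weight (n : ℕ) (θ1 θ2 : ℝ) : Measurable (weight n θ1 θ2) :=
  ((continuous_normPrime n).measurable.pow_const θ1).mul (measurable_norm.pow_const θ2)

lemma weight_nonneg (n : ℕ) (θ1 θ2 : ℝ) (x : En n) : 0 ≤ weight n θ1 θ2 x :=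
  mul_nonneg (Real.rpow_nonneg (normPrime_nonneg n x) _) (Real.rpow_nonneg (norm_nonneg x) _)

lemma normPrime_le_norm (n : ℕ) (x : En n) : normPrime n x ≤ ‖x‖ := by
  rw [EuclideanSpace.norm_eq]
  refine Real.sqrt_le_sqrt (Finset.sum_le_sum fun i _ => ?_)
  split_ifs
  · simp
  · positivity

lemma normPrime_smul (n : ℕ) {r : ℝ} (hr : 0 ≤ r) (x : En n) :
    normPrime n (r • x) = r * normPrime n x := by
  have h : ∀ i : Fin n, (if (i : ℕ) + 1 < n then ((r • x) i) ^ 2 else 0) =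
      r ^ 2 * (if (i : ℕ) + 1 < n then (x i) ^ 2 else 0) := fun i => by
    split_ifs <;> simp [mul_pow]
  simp only [normPrime, h, ← Finset.mul_sum]
  rw [Real.sqrt_mul (sq_nonneg r), Real.sqrt_sq hr]

/-- The weight is positively homogeneous of degree `θ1 + θ2`. -/
lemma weight_smul (n : ℕ) (θ1 θ2 : ℝ) {r : ℝ} (hr : 0 < r) (x : En n) :
    weight n θ1 θ2 (r • x) = r ^ (θ1 + θ2) * weight n θ1 θ2 x := by
  rw [weight, weight, normPrime_smul n hr.le, norm_smul, Real.norm_of_nonneg hr.le,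
    Real.mul_rpow hr.le (normPrime_nonneg n x), Real.mul_rpow hr.le (norm_nonneg x),
    Real.rpow_add hr]
  ring

/-- Scaling of the weighted measure of balls centred at the origin. -/
lemma muW_ball (n : ℕ) (θ1 θ2 : ℝ) {R : ℝ} (hR : 0 < R) :
    muW n θ1 θ2 (ball (0 : En n) R) =
      ENNReal.ofReal (R ^ ((n : ℝ) + θ1 + θ2)) * muW n θ1 θ2 (ball (0 : En n) 1) := by
  have hmeas : Measurable fun x : En n => ENNReal.ofReal (weight n θ1 θ2 x) :=
    (measurable_weight n θ1 θ2).ennreal_ofReal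
  have hpre : (fun x : En n => R⁻¹ • x) ⁻¹' ball 0 1 = ball 0 R := by
    ext x
    simp only [mem_preimage, mem_ball_zero_iff, norm_smul, norm_inv, Real.norm_of_nonneg hR.le]
    rw [inv_mul_lt_iff₀ hR, mul_one]
  have hmap := Measure.map_addHaar_smul (volume : Measure (En n)) (inv_ne_zero hR.ne')
  have hcalc : ∀ x : En n, ENNReal.ofReal (weight n θ1 θ2 x) =
      ENNReal.ofReal (R ^ (θ1 + θ2)) * ENNReal.ofReal (weight n θ1 θ2 (R⁻¹ • x)) := fun x => by
    rw [← ENNReal.ofReal_mul (by positivity), ← weight_smul n θ1 θ2 hR, smul_inv_smul₀ hR.ne']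
  have hm : Measurable fun x : En n => R⁻¹ • x := measurable_const_smul _
  rw [muW, withDensity_apply _ measurableSet_ball, withDensity_apply _ measurableSet_ball,
    lintegral_congr hcalc, lintegral_const_mul' _ _ ENNReal.ofReal_ne_top, ← hpre,
    ← setLIntegral_map measurableSet_ball hmeas hm, hmap, Measure.restrict_smul,
    lintegral_smul_measure, smul_eq_mul, ← mul_assoc, ← ENNReal.ofReal_mul (by positivity)]
  congr 2
  rw [finrank_euclideanSpace_fin, inv_pow, inv_inv, abs_of_pos (by positivity),
    ← Real.rpow_natCast R n, ← Real.rpow_add hR]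
  congr 1
  ring

lemma muW_ball_one_pos {n : ℕ} (hn : 2 ≤ n) (θ1 θ2 : ℝ) :
    0 < muW n θ1 θ2 (ball (0 : En n) 1) := by
  rw [muW, withDensity_apply _ measurableSet_ball,
    setLIntegral_pos_iff (measurable_weight n θ1 θ2).ennreal_ofReal]
  have hopen : IsOpen ({x : En n | 0 < normPrime n x} ∩ ball 0 1) :=
    (isOpen_lt continuous_const (continuous_normPrime n)).inter isOpen_ball
  have hne : ({x : En n | 0 < normPrime n x} ∩ ball 0 1).Nonempty := by
    refine ⟨EuclideanSpace.single ⟨0, by omega⟩ (1 / 2), ?_, ?_⟩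
    · refine Real.sqrt_pos.2 (Finset.sum_pos' (fun i _ => by positivity)
        ⟨⟨0, by omega⟩, Finset.mem_univ _, ?_⟩)
      rw [if_pos (by simp only; omega)]
      simp
    · rw [mem_ball_zero_iff, PiLp.norm_single]
      norm_num
  refine (hopen.measure_pos volume hne).trans_le (measure_mono (inter_subset_inter_left _ ?_))
  intro x (hx : 0 < normPrime n x)
  have hx' : 0 < ‖x‖ := hx.trans_le (normPrime_le_norm n x)
  exact (ENNReal.ofReal_pos.2 (mul_pos (Real.rpow_pos_of_pos hx _)
    (Real.rpow_pos_of_pos hx' _))).ne'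

/-- The splitting `x ↦ (x', x_n)`. -/
def splitLast (m : ℕ) (x : En (m + 1)) : En m × ℝ :=
  (WithLp.toLp 2 fun i => x i.castSucc, x (Fin.last m))

lemma measurePreserving_splitLast (m : ℕ) : MeasurePreserving (splitLast m) := by
  have h1 := PiLp.volume_preserving_ofLp (Fin (m + 1))
  have h2 := volume_preserving_piFinSuccAbove (fun _ : Fin (m + 1) => ℝ) (Fin.last m)
  have h3 : MeasurePreserving (Prod.map (WithLp.toLp 2) id : (Fin m → ℝ) × ℝ → En m × ℝ) :=
    (PiLp.volume_preserving_toLp (Fin m)).prod (MeasurePreserving.id volume)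
  have h4 : MeasurePreserving (Prod.swap : ℝ × (Fin m → ℝ) → (Fin m → ℝ) × ℝ) :=
    Measure.measurePreserving_swap
  convert h3.comp (h4.comp (h2.comp h1)) using 1
  ext x i
  · simp [splitLast, MeasurableEquiv.piFinSuccAbove, Fin.init]
  · simp [splitLast, MeasurableEquiv.piFinSuccAbove]

lemma normPrime_eq_norm_splitLast (m : ℕ) (x : En (m + 1)) :
    normPrime (m + 1) x = ‖(splitLast m x).1‖ := by
  simp [normPrime, EuclideanSpace.norm_eq, splitLast, Fin.sum_univ_castSucc]

lemma abs_splitLast_le_norm (m : ℕ) (x : En (m + 1)) : |(splitLast m x).2| ≤ ‖x‖ :=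
  PiLp.norm_apply_le x (Fin.last m)

lemma ae_splitLast_ne_zero {m : ℕ} (hm : 1 ≤ m) :
    ∀ᵐ x : En (m + 1), (splitLast m x).1 ≠ 0 ∧ (splitLast m x).2 ≠ 0 := by
  have : Nonempty (Fin m) := ⟨⟨0, hm⟩⟩
  have hq := (measurePreserving_splitLast m).quasiMeasurePreserving
  have h1 : ∀ᵐ y : En m, y ≠ 0 := compl_mem_ae_iff.2 (measure_singleton 0)
  have h2 : ∀ᵐ t : ℝ, t ≠ 0 := compl_mem_ae_iff.2 (measure_singleton 0)
  exact (hq.ae (Measure.quasiMeasurePreserving_fst.ae h1)).and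
    (hq.ae (Measure.quasiMeasurePreserving_snd.ae h2))

lemma integrableOn_ball_norm_rpow {E : Type*} [NormedAddCommGroup E] [NormedSpace ℝ E]
    [FiniteDimensional ℝ E] [MeasurableSpace E] [BorelSpace E] (μ : Measure E)
    [μ.IsAddHaarMeasure] (hd : 1 ≤ Module.finrank ℝ E) {a : ℝ}
    (ha : -(Module.finrank ℝ E : ℝ) < a) (r : ℝ) :
    IntegrableOn (fun x : E => ‖x‖ ^ a) (ball 0 r) μ := by
  refine integrableOn_ball_of_norm_le_rpow (C := 1) (α := -a) hd (by linarith)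
    (ae_of_all _ fun x => ?_) (measurable_norm.pow_const a).aestronglyMeasurable
  rw [neg_neg, one_mul, Real.norm_of_nonneg (by positivity)]

lemma integrableOn_splitLast_rpow {m : ℕ} (hm : 1 ≤ m) {a b : ℝ} (ha : -(m : ℝ) < a)
    (hb : -1 < b) :
    IntegrableOn (fun x : En (m + 1) => ‖(splitLast m x).1‖ ^ a * |(splitLast m x).2| ^ b)
      (ball 0 1) := by
  have h1 : IntegrableOn (fun y : En m => ‖y‖ ^ a) (ball 0 1) :=
    integrableOn_ball_norm_rpow volume (by simpa) (by simpa) 1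
  have h2 : IntegrableOn (fun t : ℝ => ‖t‖ ^ b) (ball 0 1) :=
    integrableOn_ball_norm_rpow volume (by simp) (by simpa) 1
  have h3 := Integrable.mul_prod h1 h2
  rw [Measure.prod_restrict] at h3
  have h4 := ((measurePreserving_splitLast m).restrict_preimage
    (measurableSet_ball.prod measurableSet_ball)).integrable_comp_of_integrable h3
  refine IntegrableOn.mono_set h4 fun x hx => ?_
  rw [mem_ball_zero_iff] at hx
  simp only [mem_preimage, mem_prod, mem_ball_zero_iff, Real.norm_eq_abs]
  exact ⟨(normPrime_eq_norm_splitLast m x ▸ normPrime_le_norm _ x).trans_lt hx,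
    (abs_splitLast_le_norm m x).trans_lt hx⟩

lemma exists_exponents {p θ : ℝ} (hp : 0 < p) (hθ : -(p + 1) < θ) :
    ∃ s t : ℝ, 0 ≤ s ∧ 0 ≤ t ∧ s < p ∧ t < 1 ∧ -(s + t) ≤ θ := by
  by_cases h : θ < 0
  · have hl : -θ / (p + 1) < 1 := by rw [div_lt_one (by linarith)]; linarith
    have hl0 : 0 ≤ -θ / (p + 1) := div_nonneg (by linarith) (by linarith)
    have he : -θ / (p + 1) * p + -θ / (p + 1) = -θ := by field_simp; ring
    exact ⟨-θ / (p + 1) * p, -θ / (p + 1), by positivity, hl0, by nlinarith, hl, by linarith⟩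
  · exact ⟨0, 0, le_rfl, le_rfl, hp, one_pos, by linarith⟩

lemma integrableOn_weight_ball_one {m : ℕ} (hm : 1 ≤ m) {θ1 θ2 : ℝ} (h1 : -(m : ℝ) < θ1)
    (h2 : -((m : ℝ) + 1) < θ1 + θ2 ∨ 0 ≤ θ2) :
    IntegrableOn (weight (m + 1) θ1 θ2) (ball 0 1) := by
  obtain ⟨s, t, hs, ht, hsp, ht1, hst⟩ :=
    exists_exponents (p := θ1 + m) (θ := θ2) (by linarith) (by rcases h2 with h | h <;> linarith)
  refine Integrable.mono' (integrableOn_splitLast_rpow hm (a := θ1 + -s) (b := -t)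
    (by linarith) (by linarith)) (measurable_weight _ θ1 θ2).aestronglyMeasurable ?_
  filter_upwards [ae_restrict_of_ae (ae_splitLast_ne_zero hm),
    ae_restrict_mem measurableSet_ball] with x ⟨hx1, hx2⟩ hx
  rw [mem_ball_zero_iff] at hx
  have hy : 0 < ‖(splitLast m x).1‖ := norm_pos_iff.2 hx1
  have hz : 0 < |(splitLast m x).2| := abs_pos.2 hx2
  have hyx : ‖(splitLast m x).1‖ ≤ ‖x‖ :=
    normPrime_eq_norm_splitLast m x ▸ normPrime_le_norm _ x
  have hx0 : 0 < ‖x‖ := hy.trans_le hyx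
  rw [Real.norm_of_nonneg (weight_nonneg _ _ _ _), weight, normPrime_eq_norm_splitLast,
    Real.rpow_add hy, mul_assoc]
  gcongr
  calc ‖x‖ ^ θ2 ≤ ‖x‖ ^ (-s + -t) :=
        Real.rpow_le_rpow_of_exponent_ge hx0 hx.le (by linarith)
    _ = ‖x‖ ^ (-s) * ‖x‖ ^ (-t) := Real.rpow_add hx0 _ _
    _ ≤ _ := mul_le_mul (Real.rpow_le_rpow_of_nonpos hy hyx (by linarith))
        (Real.rpow_le_rpow_of_nonpos hz (abs_splitLast_le_norm m x) (by linarith))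
        (by positivity) (by positivity)

lemma muW_ball_one_lt_top {n : ℕ} (hn : 2 ≤ n) {θ1 θ2 : ℝ}
    (hθ : (θ1, θ2) ∈ setA n ∪ setB n) : muW n θ1 θ2 (ball (0 : En n) 1) < ∞ := by
  obtain ⟨m, rfl⟩ : ∃ m, n = m + 1 := ⟨n - 1, by omega⟩
  have hint : IntegrableOn (weight (m + 1) θ1 θ2) (ball 0 1) := by
    simp only [setA, setB, mem_union, mem_ofPred_eq, Nat.cast_add, Nat.cast_one,
      add_sub_cancel_right] at hθ
    rcases hθ with ⟨h1, h2⟩ | ⟨h1, -, h2⟩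
    · exact integrableOn_weight_ball_one (by omega) h1 (.inr h2)
    · exact integrableOn_weight_ball_one (by omega) h1 (.inl h2)
  rw [muW, withDensity_apply _ measurableSet_ball]
  exact hint.lintegral_lt_top

lemma locallyIntegrable_weight {n : ℕ} {θ1 θ2 : ℝ}
    (h : muW n θ1 θ2 (ball (0 : En n) 1) < ∞) : LocallyIntegrable (weight n θ1 θ2) := by
  intro x
  have hR : 0 < ‖x‖ + 1 := by positivity
  refine ⟨ball 0 (‖x‖ + 1), isOpen_ball.mem_nhds (by simp), ?_⟩
  refine ⟨(measurable_weight n θ1 θ2).aestronglyMeasurable, ?_⟩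
  rw [hasFiniteIntegral_iff_ofReal (ae_of_all _ (weight_nonneg n θ1 θ2)),
    ← withDensity_apply _ measurableSet_ball, ← muW, muW_ball n θ1 θ2 hR]
  exact ENNReal.mul_lt_top ENNReal.ofReal_lt_top h

/-- for `(θ1,θ2) ∈ 𝒜 ∪ ℬ`, the weight `w = |x'|^θ1 |x|^θ2` is locally
integrable, and `μ(B_R(0)) ∼ R^(n+θ1+θ2)`. -/
theorem weight_locallyIntegrable_and_ball_measure (n : ℕ) (hn : 2 ≤ n) (θ1 θ2 : ℝ)
    (hθ : (θ1, θ2) ∈ setA n ∪ setB n) :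
    LocallyIntegrable (weight n θ1 θ2) (volume : Measure (En n)) ∧
    ∃ C : ℝ, 1 ≤ C ∧ ∀ R : ℝ, 0 < R →
      ENNReal.ofReal (C⁻¹ * R ^ ((n : ℝ) + θ1 + θ2)) ≤ muW n θ1 θ2 (ball (0 : En n) R) ∧
      muW n θ1 θ2 (ball (0 : En n) R) ≤ ENNReal.ofReal (C * R ^ ((n : ℝ) + θ1 + θ2)) := by
  have hpos := muW_ball_one_pos hn θ1 θ2
  have hfin := muW_ball_one_lt_top hn hθ
  refine ⟨locallyIntegrable_weight hfin, ?_⟩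
  set M := (muW n θ1 θ2 (ball (0 : En n) 1)).toReal with hM
  have hM0 : 0 < M := ENNReal.toReal_pos hpos.ne' hfin.ne
  refine ⟨max 1 (max M M⁻¹), le_max_left _ _, fun R hR => ?_⟩
  have hMR : muW n θ1 θ2 (ball (0 : En n) R) =
      ENNReal.ofReal (M * R ^ ((n : ℝ) + θ1 + θ2)) := by
    rw [muW_ball n θ1 θ2 hR, ENNReal.ofReal_mul hM0.le, hM, ENNReal.ofReal_toReal hfin.ne, mul_comm]
  rw [hMR]
  constructor <;> refine ENNReal.ofReal_le_ofReal
    (mul_le_mul_of_nonneg_right ?_ (by positivity))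
  · exact inv_le_of_inv_le₀ hM0 ((le_max_right _ _).trans (le_max_right _ _))
  · exact (le_max_left _ _).trans (le_max_right _ _)
end
end

section
/- Let n ≥ 2, 1 < q < ∞, and suppose (θ1,θ2) ∈ [(A ∪ B) ∩ (C_q ∪ D_q)] ∪ {(θ1,θ2) : θ1 = 0, θ2 > −n}. Then there exists a constant C = C(n,q,θ1,θ2) > 0 such that for every ball B = B_R(x̄) ⊂ ℝ^n with R > 0 and every continuously differentiable function φ : ℝ^n → ℝ, one has ∫_B |φ − φ_B|^q dμ ≤ C R^q ∫_B |∇φ|^q dμ, where φ_B = μ(B)^{-1} ∫_B φ dμ and dμ = |x'|^{θ1}|x|^{θ2} dx (weighted Poincaré inequality). -/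
open MeasureTheory Metric Set
open scoped ENNReal NNReal Topology

noncomputable section

lemma intervalIntegrable_abs_rpow {γ : ℝ} (hγ : -1 < γ) :
    IntervalIntegrable (fun t : ℝ => |t| ^ γ) volume (-1) 1 := by
  have h1 : IntervalIntegrable (fun t : ℝ => |t| ^ γ) volume 0 1 := by
    refine (intervalIntegral.intervalIntegrable_rpow' hγ).congr ?_
    intro t ht
    rw [uIoc_of_le zero_le_one] at ht
    simp only [abs_of_pos ht.1]
  have h2 : IntervalIntegrable (fun t : ℝ => |t| ^ γ) volume (-1) 0 := by
    have := h1.comp_mul_left (c := -1)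
    simpa using this.symm
  exact h2.trans h1

lemma abs_sub_rpow_eq {γ s ρ : ℝ} (hρ : 0 < ρ) (t : ℝ) :
    |t - s| ^ γ = ρ ^ γ * |t / ρ - s / ρ| ^ γ := by
  rw [← Real.mul_rpow hρ.le (abs_nonneg _)]
  congr 1
  rw [← sub_div, abs_div, abs_of_pos hρ]
  field_simp

lemma integrableOn_abs_sub_rpow {γ : ℝ} (hγ : -1 < γ) (s : ℝ) {ρ : ℝ} (hρ : 0 < ρ) :
    IntegrableOn (fun t : ℝ => |t - s| ^ γ) (Ioo (s - ρ) (s + ρ)) := by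
  have h := ((intervalIntegrable_abs_rpow hγ).comp_mul_left (c := ρ⁻¹)).comp_sub_right s
  have hle : s - ρ ≤ s + ρ := by linarith
  have e : (-1 / ρ⁻¹ + s) = s - ρ := by field_simp; ring
  have e' : (1 / ρ⁻¹ + s) = s + ρ := by field_simp; ring
  rw [e, e'] at h
  have h2 := (intervalIntegrable_iff_integrableOn_Ioo_of_le hle).1 (h.const_mul (ρ ^ γ))
  refine h2.congr_fun (fun t _ => ?_) measurableSet_Ioo
  simp only [abs_sub_rpow_eq (s := s) hρ t]
  congr 3
  field_simp

lemma integral_abs_sub_rpow {γ : ℝ} (s : ℝ) {ρ : ℝ} (hρ : 0 < ρ) :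
    ∫ t in Ioo (s - ρ) (s + ρ), |t - s| ^ γ = (∫ t in (-1 : ℝ)..1, |t| ^ γ) * ρ ^ (1 + γ) := by
  have hle : s - ρ ≤ s + ρ := by linarith
  rw [← integral_Ioc_eq_integral_Ioo, ← intervalIntegral.integral_of_le hle]
  simp_rw [abs_sub_rpow_eq (γ := γ) (s := s) hρ]
  rw [intervalIntegral.integral_const_mul,
    intervalIntegral.integral_comp_div_sub (fun t => |t| ^ γ) hρ.ne' (s / ρ)]
  have e : (s - ρ) / ρ - s / ρ = -1 := by field_simp; ring
  have e' : (s + ρ) / ρ - s / ρ = 1 := by field_simp; ring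
  rw [e, e', Real.rpow_add hρ, Real.rpow_one, smul_eq_mul]
  ring

/-- Product power weights have homogeneous integrals on cubes. -/
lemma exists_lintegral_cube_prod_rpow_le {n : ℕ} (γ : Fin n → ℝ) (hγ : ∀ i, -1 < γ i) :
    ∃ K : ℝ≥0, ∀ (s : Fin n → ℝ) (ρ : ℝ), 0 < ρ →
      ∫⁻ x in {x : En n | ∀ i, |x i - s i| < ρ}, ENNReal.ofReal (∏ i, |x i - s i| ^ γ i)
        ≤ K * ENNReal.ofReal (ρ ^ ((n : ℝ) + ∑ i, γ i)) := by
  refine ⟨Real.toNNReal (∏ i, ∫ t in (-1 : ℝ)..1, |t| ^ γ i), fun s ρ hρ => ?_⟩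
  have hset : {x : En n | ∀ i, |x i - s i| < ρ} =
      (MeasurableEquiv.toLp 2 (Fin n → ℝ)).symm ⁻¹'
        (univ.pi fun i => Ioo (s i - ρ) (s i + ρ)) := by
    ext x
    simp only [mem_ofPred_eq, mem_preimage, mem_univ_pi, mem_Ioo, abs_lt]
    refine forall_congr' fun i => ?_
    change _ ↔ s i - ρ < x i ∧ x i < s i + ρ
    constructor <;> rintro ⟨h1, h2⟩ <;> constructor <;> linarith
  rw [hset]
  have key := (EuclideanSpace.volume_preserving_symm_measurableEquiv_toLp
    (Fin n)).setLIntegral_comp_preimage_emb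
    (MeasurableEquiv.measurableEmbedding _)
    (fun x : Fin n → ℝ => ENNReal.ofReal (∏ i, |x i - s i| ^ γ i))
    (univ.pi fun i => Ioo (s i - ρ) (s i + ρ))
  refine (le_of_eq key).trans ?_
  rw [volume_pi, Measure.restrict_pi_pi, ← ofReal_integral_eq_lintegral_ofReal]
  · rw [integral_fintype_prod_eq_prod (𝕜 := ℝ) (fun i t => |t - s i| ^ γ i)]
    simp_rw [integral_abs_sub_rpow _ hρ]
    rw [Finset.prod_mul_distrib, ← Real.rpow_sum_of_pos hρ, ENNReal.ofReal_mul]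
    · simp [Finset.sum_add_distrib, ENNReal.ofReal]
    · exact Finset.prod_nonneg fun i _ =>
        intervalIntegral.integral_nonneg (by norm_num) fun t _ => by positivity
  · exact Integrable.fintype_prod (f := fun i t => |t - s i| ^ γ i)
      fun i => integrableOn_abs_sub_rpow (hγ i) (s i) hρ
  · exact Filter.Eventually.of_forall fun x => Finset.prod_nonneg fun i _ => by positivity

lemma normPrime_eq_norm (n : ℕ) (x : En n) :
    normPrime n x =
      ‖(WithLp.toLp 2 fun i : Fin n => if (i : ℕ) + 1 < n then x i else 0 : En n)‖ := by
  rw [normPrime, EuclideanSpace.norm_eq]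
  congr 1
  refine Finset.sum_congr rfl fun i _ => ?_
  by_cases h : (i : ℕ) + 1 < n <;> simp [h]

lemma abs_normPrime_sub_le (n : ℕ) (x y : En n) : |normPrime n x - normPrime n y| ≤ ‖x - y‖ := by
  refine le_trans ?_ (normPrime_le_norm n (x - y))
  rw [normPrime_eq_norm, normPrime_eq_norm, normPrime_eq_norm]
  refine (abs_norm_sub_norm_le _ _).trans (le_of_eq ?_)
  congr 1
  ext i
  by_cases h : (i : ℕ) + 1 < n <;> simp [h]

lemma abs_apply_le_normPrime {n : ℕ} (x : En n) {i : Fin n} (hi : (i : ℕ) + 1 < n) :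
    |x i| ≤ normPrime n x := by
  rw [normPrime_eq_norm]
  have := PiLp.norm_apply_le
    (WithLp.toLp 2 fun i : Fin n => if (i : ℕ) + 1 < n then x i else 0 : En n) i
  simpa [hi] using this

lemma measurable_normPrime (n : ℕ) : Measurable (normPrime n) := by
  unfold normPrime
  refine Measurable.sqrt (Finset.measurable_sum _ fun i _ => ?_)
  split_ifs
  · fun_prop
  · exact measurable_const

lemma measurable_weight_s3 (n : ℕ) (a b : ℝ) : Measurable (weight n a b) :=
  ((measurable_normPrime n).pow_const a).mul (measurable_norm.pow_const b)

lemma ae_forall_apply_ne_zero (n : ℕ) : ∀ᵐ x : En n, ∀ i, x i ≠ 0 := by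
  rw [ae_all_iff]
  intro i
  exact (PiLp.volume_preserving_ofLp (Fin n)).quasiMeasurePreserving.ae
    (Measure.ae_eval_ne (fun _ : Fin n => (volume : Measure ℝ)) i 0)

/-- Integrals of `|x'|^α |x_n - σ|^β` over cylinders of size `ρ`. -/
lemma exists_lintegral_cylinder_le {m : ℕ} (hm : 1 ≤ m) {α β : ℝ} (hα : -(m : ℝ) < α)
    (hβ : -1 < β) :
    ∃ K : ℝ≥0, ∀ σ ρ : ℝ, 0 < ρ →
      ∫⁻ x in {x : En (m + 1) | normPrime (m + 1) x < ρ ∧ |x (Fin.last m) - σ| < ρ},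
        ENNReal.ofReal (normPrime (m + 1) x ^ α * |x (Fin.last m) - σ| ^ β)
        ≤ K * ENNReal.ofReal (ρ ^ ((m : ℝ) + 1 + α + β)) := by
  have hm0 : (0 : ℝ) < m := by exact_mod_cast hm
  set α' := min α 0 with hα'
  have hα'0 : α' ≤ 0 := min_le_right _ _
  have hα'α : α' ≤ α := min_le_left _ _
  have hα'm : -1 < α' / m := by
    rw [lt_div_iff₀ hm0]
    simp only [hα', lt_min_iff]
    constructor <;> linarith
  obtain ⟨K, hK⟩ := exists_lintegral_cube_prod_rpow_le
    (fun i : Fin (m + 1) => if (i : ℕ) + 1 < m + 1 then α' / m else β)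
    (fun i => by split_ifs <;> assumption)
  refine ⟨K, fun σ ρ hρ => ?_⟩
  set s : Fin (m + 1) → ℝ := fun i => if (i : ℕ) + 1 < m + 1 then 0 else σ with hs
  have hK' := hK s ρ hρ
  have hsum : (((m + 1 : ℕ) : ℝ) + ∑ i : Fin (m + 1),
      if (i : ℕ) + 1 < m + 1 then α' / m else β) = (m : ℝ) + 1 + α' + β := by
    rw [Fin.sum_univ_castSucc]
    simp
    field_simp
    ring
  rw [hsum] at hK'
  calc _ ≤ ∫⁻ x in {x : En (m + 1) | normPrime (m + 1) x < ρ ∧ |x (Fin.last m) - σ| < ρ},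
        ENNReal.ofReal (ρ ^ (α - α')) * ENNReal.ofReal (∏ i, |x i - s i| ^
          (if (i : ℕ) + 1 < m + 1 then α' / m else β)) := by
        refine setLIntegral_mono_ae' ?_ ?_
        · exact (measurableSet_lt (measurable_normPrime _) measurable_const).inter
            (measurableSet_lt (f := fun x : En (m + 1) => |x (Fin.last m) - σ|)
              (by fun_prop) measurable_const)
        · filter_upwards [ae_forall_apply_ne_zero (m + 1)] with x hx hxρ
          have hpos : 0 < normPrime (m + 1) x :=
            (abs_pos.2 (hx (Fin.castSucc ⟨0, hm⟩))).trans_le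
              (abs_apply_le_normPrime x (by simp; omega))
          rw [← ENNReal.ofReal_mul (by positivity)]
          refine ENNReal.ofReal_le_ofReal ?_
          rw [Fin.prod_univ_castSucc]
          simp only [hs, Fin.val_castSucc, add_lt_add_iff_right, Fin.is_lt, if_true, sub_zero,
            Fin.val_last, lt_irrefl, if_false]
          rw [← mul_assoc]
          refine mul_le_mul_of_nonneg_right ?_ (by positivity)
          have h1 : normPrime (m + 1) x ^ α
              = normPrime (m + 1) x ^ (α - α') * normPrime (m + 1) x ^ α' := by
            rw [← Real.rpow_add hpos]; congr 1; ring
          rw [h1]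
          refine mul_le_mul (Real.rpow_le_rpow hpos.le hxρ.1.le (by linarith)) ?_
            (by positivity) (by positivity)
          have h2 : normPrime (m + 1) x ^ α'
              = ∏ _i : Fin m, normPrime (m + 1) x ^ (α' / m) := by
            rw [Finset.prod_const, Finset.card_univ, Fintype.card_fin, ← Real.rpow_natCast,
              ← Real.rpow_mul hpos.le]
            congr 1
            field_simp
          rw [h2]
          refine Finset.prod_le_prod (fun i _ => by positivity) fun i _ => ?_
          exact Real.rpow_le_rpow_of_nonpos (abs_pos.2 (hx _))
            (abs_apply_le_normPrime x (by simp)) (div_nonpos_of_nonpos_of_nonneg hα'0 hm0.le)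
    _ ≤ ENNReal.ofReal (ρ ^ (α - α')) * (K * ENNReal.ofReal (ρ ^ ((m : ℝ) + 1 + α' + β))) := by
        rw [lintegral_const_mul' _ _ ENNReal.ofReal_ne_top]
        gcongr
        refine le_trans (lintegral_mono_set ?_) hK'
        rintro x ⟨h1, h2⟩ i
        by_cases hi : (i : ℕ) + 1 < m + 1
        · have hi' : (i : ℕ) < m := by omega
          simpa [hs, hi'] using (abs_apply_le_normPrime x hi).trans_lt h1
        · have : i = Fin.last m := Fin.ext (by simp; omega)
          subst this
          simpa [hs] using h2
    _ = _ := by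
        rw [mul_left_comm, ← ENNReal.ofReal_mul (by positivity), ← Real.rpow_add hρ]
        congr 3
        ring

lemma rpow_le_two_rpow_mul_max_rpow {N N' r a : ℝ} (hN : 0 ≤ N) (hN' : 0 ≤ N') (hr : 0 < r)
    (h : |N' - N| < r) (ha : 0 ≤ a ∨ 2 * r ≤ N) :
    N' ^ a ≤ 2 ^ |a| * max N r ^ a := by
  have hX : 0 < max N r := lt_max_of_lt_right hr
  rw [abs_lt] at h
  have hNX := le_max_left N r
  have hrX := le_max_right N r
  rcases le_or_gt 0 a with h0 | h0
  · rw [abs_of_nonneg h0, ← Real.mul_rpow (by norm_num) hX.le]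
    exact Real.rpow_le_rpow hN' (by linarith) h0
  · have h2 := ha.resolve_left (not_le.2 h0)
    have : max N r = N := max_eq_left (by linarith)
    rw [this, abs_of_neg h0, Real.rpow_neg (by norm_num), ← Real.inv_rpow (by norm_num),
      ← Real.mul_rpow (by norm_num) hN]
    exact Real.rpow_le_rpow_of_nonpos (by linarith) (by linarith) h0.le

lemma abs_norm_sub_lt_of_mem_ball {n : ℕ} {c x : En n} {r : ℝ} (hx : x ∈ ball c r) :
    |‖x‖ - ‖c‖| < r :=
  (abs_norm_sub_norm_le x c).trans_lt (by simpa [dist_eq_norm] using hx)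

lemma abs_normPrime_sub_lt_of_mem_ball {n : ℕ} {c x : En n} {r : ℝ} (hx : x ∈ ball c r) :
    |normPrime n x - normPrime n c| < r :=
  (abs_normPrime_sub_le n x c).trans_lt (by simpa [dist_eq_norm] using hx)

lemma rpow_le_two_rpow_mul_max_rpow_of_lt {N r : ℝ} (a : ℝ) (hr : 0 < r) (hN : N < 2 * r) :
    r ^ a ≤ 2 ^ |a| * max N r ^ a := by
  have hX : 0 < max N r := lt_max_of_lt_right hr
  rcases le_or_gt a 0 with ha | ha
  · rw [abs_of_nonpos ha, Real.rpow_neg (by norm_num), ← Real.inv_rpow (by norm_num),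
      ← Real.mul_rpow (by norm_num) hX.le]
    have : max N r ≤ 2 * r := max_le hN.le (by linarith)
    exact Real.rpow_le_rpow_of_nonpos (by linarith) (by linarith) ha
  · calc r ^ a ≤ max N r ^ a := Real.rpow_le_rpow hr.le (le_max_right _ _) ha.le
      _ ≤ _ := le_mul_of_one_le_left (by positivity)
          (Real.one_le_rpow (by norm_num) (abs_nonneg a))

lemma volume_ball_eq {n : ℕ} (c : En n) {r : ℝ} (hr : 0 < r) :
    volume (ball c r) = ENNReal.ofReal (r ^ (n : ℝ)) * volume (ball (0 : En n) 1) := by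
  rw [Measure.addHaar_ball_of_pos volume c hr, finrank_euclideanSpace_fin, Real.rpow_natCast]

lemma exists_lintegral_ball_normPrime_rpow_le {m : ℕ} (hm : 1 ≤ m) {a : ℝ} (ha : -(m : ℝ) < a) :
    ∃ K : ℝ≥0∞, K ≠ ⊤ ∧ ∀ (c : En (m + 1)) (r : ℝ), 0 < r →
      ∫⁻ x in ball c r, ENNReal.ofReal (normPrime (m + 1) x ^ a)
        ≤ K * ENNReal.ofReal (r ^ ((m + 1 : ℕ) : ℝ) * max (normPrime (m + 1) c) r ^ a) := by
  obtain ⟨K, hK⟩ := exists_lintegral_cylinder_le hm ha (show (-1 : ℝ) < 0 by norm_num)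
  set V := volume (ball (0 : En (m + 1)) 1)
  refine ⟨ENNReal.ofReal (2 ^ |a|) * V + K * ENNReal.ofReal (3 ^ ((m : ℝ) + 1 + a) * 2 ^ |a|),
    by finiteness, fun c r hr => ?_⟩
  have hX : 0 < max (normPrime (m + 1) c) r := lt_max_of_lt_right hr
  rw [add_mul]
  by_cases h : 0 ≤ a ∨ 2 * r ≤ normPrime (m + 1) c
  · refine le_trans ?_ le_self_add
    calc _ ≤ ∫⁻ _x in ball c r, ENNReal.ofReal (2 ^ |a| * max (normPrime (m + 1) c) r ^ a) := by
          refine setLIntegral_mono measurable_const fun x hx => ENNReal.ofReal_le_ofReal ?_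
          exact rpow_le_two_rpow_mul_max_rpow (normPrime_nonneg _ _) (normPrime_nonneg _ _) hr
            (abs_normPrime_sub_lt_of_mem_ball hx) h
      _ = _ := by
          rw [setLIntegral_const, volume_ball_eq c hr, ENNReal.ofReal_mul (by positivity),
            ENNReal.ofReal_mul (by positivity)]
          ring
  · push Not at h
    refine le_trans ?_ le_add_self
    calc _ ≤ ∫⁻ x in {x : En (m + 1) | normPrime (m + 1) x < 3 * r ∧
            |x (Fin.last m) - c (Fin.last m)| < 3 * r},
          ENNReal.ofReal (normPrime (m + 1) x ^ a * |x (Fin.last m) - c (Fin.last m)| ^ (0 : ℝ)) := by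
          simp only [Real.rpow_zero, mul_one]
          refine lintegral_mono_set fun x hx => ⟨?_, ?_⟩
          · have := abs_normPrime_sub_lt_of_mem_ball hx
            rw [abs_lt] at this
            linarith
          · have h1 := PiLp.norm_apply_le (x - c) (Fin.last m)
            rw [mem_ball, dist_eq_norm] at hx
            rw [PiLp.sub_apply, Real.norm_eq_abs] at h1
            linarith
      _ ≤ K * ENNReal.ofReal ((3 * r) ^ ((m : ℝ) + 1 + a + 0)) := hK _ _ (by positivity)
      _ ≤ _ := by
          rw [mul_assoc]
          gcongr
          rw [← ENNReal.ofReal_mul (by positivity)]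
          refine ENNReal.ofReal_le_ofReal ?_
          rw [add_zero, Real.mul_rpow (by norm_num) hr.le, mul_assoc]
          gcongr
          rw [Real.rpow_add hr, mul_left_comm]
          push_cast
          gcongr
          exact rpow_le_two_rpow_mul_max_rpow_of_lt a hr h.2

lemma norm_rpow_le_normPrime_rpow_mul {m : ℕ} (x : En (m + 1)) {b b₁ b₂ : ℝ} (hb : b₁ + b₂ = b)
    (h₁ : b₁ ≤ 0) (h₂ : b₂ ≤ 0) (hx : 0 < normPrime (m + 1) x) (hx' : x (Fin.last m) ≠ 0) :
    ‖x‖ ^ b ≤ normPrime (m + 1) x ^ b₁ * |x (Fin.last m)| ^ b₂ := by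
  have hpos : 0 < ‖x‖ := hx.trans_le (normPrime_le_norm _ x)
  rw [← hb, Real.rpow_add hpos]
  refine mul_le_mul ?_ ?_ (by positivity) (by positivity)
  · exact Real.rpow_le_rpow_of_nonpos hx (normPrime_le_norm _ x) h₁
  · exact Real.rpow_le_rpow_of_nonpos (abs_pos.2 hx') (PiLp.norm_apply_le x _) h₂

lemma ae_normPrime_pos {n : ℕ} (hn : 2 ≤ n) : ∀ᵐ x : En n, 0 < normPrime n x := by
  filter_upwards [ae_forall_apply_ne_zero n] with x hx
  exact (abs_pos.2 (hx ⟨0, by omega⟩)).trans_le (abs_apply_le_normPrime x hn)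

/-- The mean of the weight over a ball is controlled by its size at distance `r` from the center. -/
lemma exists_lintegral_ball_weight_le {n : ℕ} (hn : 2 ≤ n) {a b : ℝ}
    (hab : (a, b) ∈ setA n ∪ setB n) :
    ∃ K : ℝ≥0∞, K ≠ ⊤ ∧ ∀ (c : En n) (r : ℝ), 0 < r →
      ∫⁻ x in ball c r, ENNReal.ofReal (weight n a b x)
        ≤ K * ENNReal.ofReal (r ^ (n : ℝ) * max (normPrime n c) r ^ a * max ‖c‖ r ^ b) := by
  obtain ⟨m, rfl⟩ : ∃ m, n = m + 1 := ⟨n - 1, by omega⟩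
  have hm : 1 ≤ m := by omega
  have ha : -(m : ℝ) < a := by
    rcases hab with h | h <;> simpa using h.1
  obtain ⟨K₁, hK₁, h₁⟩ := exists_lintegral_ball_normPrime_rpow_le hm ha
  have main : ∀ (c : En (m + 1)) (r : ℝ), 0 < r → (0 ≤ b ∨ 2 * r ≤ ‖c‖) →
      ∫⁻ x in ball c r, ENNReal.ofReal (weight (m + 1) a b x)
        ≤ ENNReal.ofReal (2 ^ |b|) * K₁ * ENNReal.ofReal
          (r ^ ((m + 1 : ℕ) : ℝ) * max (normPrime (m + 1) c) r ^ a * max ‖c‖ r ^ b) := by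
    intro c r hr h
    have hX : 0 < max (normPrime (m + 1) c) r := lt_max_of_lt_right hr
    have hY : 0 < max ‖c‖ r := lt_max_of_lt_right hr
    calc _ ≤ ∫⁻ x in ball c r, ENNReal.ofReal (2 ^ |b| * max ‖c‖ r ^ b) *
            ENNReal.ofReal (normPrime (m + 1) x ^ a) := by
          refine setLIntegral_mono
            (((measurable_normPrime _).pow_const a).ennreal_ofReal.const_mul _) fun x hx => ?_
          rw [← ENNReal.ofReal_mul (by positivity), mul_comm, weight]
          refine ENNReal.ofReal_le_ofReal (mul_le_mul_of_nonneg_left ?_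
            (Real.rpow_nonneg (normPrime_nonneg _ _) _))
          exact rpow_le_two_rpow_mul_max_rpow (norm_nonneg _) (norm_nonneg _) hr
            (abs_norm_sub_lt_of_mem_ball hx) h
      _ ≤ ENNReal.ofReal (2 ^ |b| * max ‖c‖ r ^ b) * (K₁ * ENNReal.ofReal
            (r ^ ((m + 1 : ℕ) : ℝ) * max (normPrime (m + 1) c) r ^ a)) := by
          rw [lintegral_const_mul' _ _ ENNReal.ofReal_ne_top]
          gcongr
          exact h₁ c r hr
      _ = _ := by
          rw [ENNReal.ofReal_mul (by positivity), ENNReal.ofReal_mul (by positivity)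
            (q := max ‖c‖ r ^ b)]
          ring
  by_cases hb : 0 ≤ b
  · exact ⟨_, by finiteness, fun c r hr => main c r hr (Or.inl hb)⟩
  push Not at hb
  have habn : -((m : ℝ) + 1) < a + b := by
    rcases hab with h | h
    · exact absurd h.2 (not_le.2 hb)
    · simpa using h.2.2
  obtain ⟨b₂, hb₂l, hb₂r⟩ : ∃ b₂, max b (-1) < b₂ ∧ b₂ < min 0 (a + b + m) := by
    refine exists_between ?_
    simp only [max_lt_iff, lt_min_iff]
    refine ⟨⟨hb, ?_⟩, ?_, ?_⟩ <;> linarith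
  rw [max_lt_iff] at hb₂l
  rw [lt_min_iff] at hb₂r
  obtain ⟨K₂, hK₂⟩ := exists_lintegral_cylinder_le hm (α := a + (b - b₂)) (β := b₂)
    (by linarith) hb₂l.2
  refine ⟨ENNReal.ofReal (2 ^ |b|) * K₁ +
    K₂ * ENNReal.ofReal (3 ^ ((m : ℝ) + 1 + a + b) * 2 ^ |a| * 2 ^ |b|),
    by finiteness, fun c r hr => ?_⟩
  have hX : 0 < max (normPrime (m + 1) c) r := lt_max_of_lt_right hr
  have hY : 0 < max ‖c‖ r := lt_max_of_lt_right hr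
  rw [add_mul]
  rcases le_or_gt (2 * r) ‖c‖ with h | h
  · exact (main c r hr (Or.inr h)).trans le_self_add
  refine le_trans ?_ le_add_self
  calc _ ≤ ∫⁻ x in ball c r, ENNReal.ofReal (normPrime (m + 1) x ^ (a + (b - b₂)) *
          |x (Fin.last m) - 0| ^ b₂) := by
        refine lintegral_mono_ae (ae_restrict_of_ae ?_)
        filter_upwards [ae_forall_apply_ne_zero (m + 1), ae_normPrime_pos hn] with x hx hx'
        refine ENNReal.ofReal_le_ofReal ?_
        rw [weight, Real.rpow_add hx', mul_assoc, sub_zero]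
        gcongr
        exact norm_rpow_le_normPrime_rpow_mul x (by ring) (by linarith) hb₂r.1.le hx' (hx _)
    _ ≤ ∫⁻ x in {x : En (m + 1) | normPrime (m + 1) x < 3 * r ∧ |x (Fin.last m) - 0| < 3 * r},
          ENNReal.ofReal (normPrime (m + 1) x ^ (a + (b - b₂)) *
          |x (Fin.last m) - 0| ^ b₂) := by
        refine lintegral_mono_set fun x hx => ?_
        have h1 := abs_norm_sub_lt_of_mem_ball hx
        rw [abs_lt] at h1
        have h2 := PiLp.norm_apply_le x (Fin.last m)
        rw [Real.norm_eq_abs] at h2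
        refine ⟨(normPrime_le_norm _ x).trans_lt (by linarith), ?_⟩
        rw [sub_zero]
        linarith
    _ ≤ K₂ * ENNReal.ofReal ((3 * r) ^ ((m : ℝ) + 1 + (a + (b - b₂)) + b₂)) :=
        hK₂ _ _ (by positivity)
    _ ≤ _ := by
        rw [mul_assoc]
        gcongr
        rw [← ENNReal.ofReal_mul (by positivity)]
        refine ENNReal.ofReal_le_ofReal ?_
        have e : (m : ℝ) + 1 + (a + (b - b₂)) + b₂ = (m : ℝ) + 1 + a + b := by ring
        rw [e, Real.mul_rpow (by norm_num) hr.le, Real.rpow_add hr, Real.rpow_add hr]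
        have hA := rpow_le_two_rpow_mul_max_rpow_of_lt a hr ((normPrime_le_norm _ c).trans_lt h)
        have hB := rpow_le_two_rpow_mul_max_rpow_of_lt b hr h
        push_cast
        calc _ ≤ 3 ^ ((m : ℝ) + 1 + a + b) * (r ^ ((m : ℝ) + 1) *
              (2 ^ |a| * max (normPrime (m + 1) c) r ^ a) * (2 ^ |b| * max ‖c‖ r ^ b)) := by
              gcongr
          _ = _ := by ring

lemma ae_one_le_weight_mul_weight {n : ℕ} (hn : 2 ≤ n) {q : ℝ} (hq : 1 < q) (a b : ℝ) :
    ∀ᵐ x : En n, 1 ≤ ENNReal.ofReal (weight n a b x) ^ (1 / q) *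
      ENNReal.ofReal (weight n (-(a / (q - 1))) (-(b / (q - 1))) x) ^ ((q - 1) / q) := by
  filter_upwards [ae_normPrime_pos hn] with x hx
  have hx' : 0 < ‖x‖ := hx.trans_le (normPrime_le_norm _ x)
  have h1 : 0 < q - 1 := by linarith
  have h0 : 0 < q := by linarith
  have hw : ∀ a b, 0 < weight n a b x := fun a b => by unfold weight; positivity
  rw [ENNReal.ofReal_rpow_of_pos (hw _ _), ENNReal.ofReal_rpow_of_pos (hw _ _),
    ← ENNReal.ofReal_mul (by have := hw a b; positivity), ← ENNReal.ofReal_one]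
  refine ENNReal.ofReal_le_ofReal (le_of_eq ?_)
  unfold weight
  rw [Real.mul_rpow (by positivity) (by positivity), Real.mul_rpow (by positivity) (by positivity),
    ← Real.rpow_mul hx.le, ← Real.rpow_mul hx.le, ← Real.rpow_mul hx'.le, ← Real.rpow_mul hx'.le,
    mul_mul_mul_comm, ← Real.rpow_add hx, ← Real.rpow_add hx']
  have e : ∀ a : ℝ, a * (1 / q) + -(a / (q - 1)) * ((q - 1) / q) = 0 := fun a => by
    field_simp; ring
  rw [e, e, Real.rpow_zero, Real.rpow_zero, mul_one]

/-- The Muckenhoupt condition for the anisotropic weight. -/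
lemma exists_muckenhoupt_weight {n : ℕ} (hn : 2 ≤ n) {q : ℝ} (hq : 1 < q) {a b : ℝ}
    (hab : (a, b) ∈ setA n ∪ setB n) (hab' : (a, b) ∈ setC n q ∪ setD n q) :
    ∃ K : ℝ≥0∞, K ≠ ⊤ ∧ ∀ (c : En n) (r : ℝ), 0 < r →
      (∫⁻ x in ball c r, ENNReal.ofReal (weight n a b x)) *
        (∫⁻ x in ball c r,
          ENNReal.ofReal (weight n (-(a / (q - 1))) (-(b / (q - 1))) x)) ^ (q - 1)
        ≤ K * ENNReal.ofReal (r ^ ((n : ℝ) * q)) := by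
  have h1 : 0 < q - 1 := by linarith
  have hdual : (-(a / (q - 1)), -(b / (q - 1))) ∈ setA n ∪ setB n := by
    have key : ∀ c : ℝ, c < ((n : ℝ) - 1) * (q - 1) → -((n : ℝ) - 1) < -(c / (q - 1)) := by
      intro c hc
      rw [neg_lt_neg_iff, div_lt_iff₀ h1]
      exact hc
    rcases hab' with h | h
    · exact Or.inl ⟨key a h.1, by
        have := div_nonpos_of_nonpos_of_nonneg h.2 h1.le
        simpa using this⟩
    · refine Or.inr ⟨key a h.1, by
        have := div_pos h.2.1 h1
        simpa using this, ?_⟩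
      have : (a + b) / (q - 1) < n := by
        rw [div_lt_iff₀ h1]; exact h.2.2
      rw [add_div] at this
      change -(n : ℝ) < -(a / (q - 1)) + -(b / (q - 1))
      linarith
  obtain ⟨K, hK, h⟩ := exists_lintegral_ball_weight_le hn hab
  obtain ⟨K', hK', h'⟩ := exists_lintegral_ball_weight_le hn hdual
  refine ⟨K * K' ^ (q - 1), by finiteness, fun c r hr => ?_⟩
  have hX : 0 < max (normPrime n c) r := lt_max_of_lt_right hr
  have hY : 0 < max ‖c‖ r := lt_max_of_lt_right hr
  refine (mul_le_mul' (h c r hr) (ENNReal.rpow_le_rpow (h' c r hr) h1.le)).trans (le_of_eq ?_)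
  rw [ENNReal.mul_rpow_of_nonneg _ _ h1.le, ENNReal.ofReal_rpow_of_pos (by positivity),
    mul_mul_mul_comm, ← ENNReal.ofReal_mul (by positivity)]
  congr 2
  rw [Real.mul_rpow (by positivity) (by positivity), Real.mul_rpow (by positivity) (by positivity),
    ← Real.rpow_mul hr.le, ← Real.rpow_mul hX.le, ← Real.rpow_mul hY.le]
  have e : ∀ a : ℝ, -(a / (q - 1)) * (q - 1) = -a := fun a => by field_simp
  rw [e, e, Real.rpow_neg hX.le, Real.rpow_neg hY.le]
  have e2 : (n : ℝ) * q = n + n * (q - 1) := by ring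
  rw [e2, Real.rpow_add hr]
  field_simp

lemma enorm_sub_le_lintegral_fderiv {n : ℕ} {φ : En n → ℝ} (hφ : ContDiff ℝ 1 φ) (x y : En n) :
    ‖φ y - φ x‖ₑ ≤ ‖y - x‖ₑ * ∫⁻ t in Ioc (0 : ℝ) 1, ‖fderiv ℝ φ (x + t • (y - x))‖ₑ := by
  have hc : Continuous (fderiv ℝ φ) := hφ.continuous_fderiv one_ne_zero
  have hd : ∀ t : ℝ, HasDerivAt (fun t : ℝ => φ (x + t • (y - x)))
      (fderiv ℝ φ (x + t • (y - x)) (y - x)) t := by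
    intro t
    have h1 : HasDerivAt (fun t : ℝ => x + t • (y - x)) (y - x) t := by
      simpa using ((hasDerivAt_id t).smul_const (y - x)).const_add x
    exact ((hφ.differentiable one_ne_zero) _).hasFDerivAt.comp_hasDerivAt t h1
  have hcont : Continuous fun t : ℝ => fderiv ℝ φ (x + t • (y - x)) (y - x) := by
    fun_prop
  have hF := intervalIntegral.integral_eq_sub_of_hasDerivAt (fun t _ => hd t)
    (hcont.intervalIntegrable 0 1)
  simp only [one_smul, zero_smul, add_zero, add_sub_cancel] at hF
  rw [← hF, intervalIntegral.integral_of_le zero_le_one]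
  refine (enorm_integral_le_lintegral_enorm _).trans ?_
  rw [← lintegral_const_mul' _ _ (by finiteness)]
  refine lintegral_mono fun t => ?_
  rw [mul_comm]
  exact ContinuousLinearMap.le_opENorm _ _

/-- Hölder's inequality for a pair of weights with `w ^ (1 / q) * v ^ ((q - 1) / q) ≥ 1`. -/
lemma lintegral_rpow_le_of_weights {α : Type*} [MeasurableSpace α] {ν : Measure α} {q : ℝ}
    (hq : 1 < q) {f w v : α → ℝ≥0∞} (hf : AEMeasurable f ν) (hw : AEMeasurable w ν)
    (hv : AEMeasurable v ν) (h : ∀ᵐ x ∂ν, 1 ≤ w x ^ (1 / q) * v x ^ ((q - 1) / q)) :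
    (∫⁻ x, f x ∂ν) ^ q ≤ (∫⁻ x, f x ^ q * w x ∂ν) * (∫⁻ x, v x ∂ν) ^ (q - 1) := by
  have h0 : 0 < q := by linarith
  have h1 : 0 < q - 1 := by linarith
  have hpq : q.HolderConjugate (q / (q - 1)) := Real.HolderConjugate.conjExponent hq
  have hH := ENNReal.lintegral_mul_le_Lp_mul_Lq ν hpq
    (f := fun x => f x * w x ^ (1 / q)) (g := fun x => v x ^ ((q - 1) / q))
    (hf.mul (hw.pow_const _)) (hv.pow_const _)
  have hle : ∫⁻ x, f x ∂ν ≤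
      ∫⁻ x, ((fun x => f x * w x ^ (1 / q)) * fun x => v x ^ ((q - 1) / q)) x ∂ν := by
    refine lintegral_mono_ae ?_
    filter_upwards [h] with x hx
    simp only [Pi.mul_apply, mul_assoc]
    exact le_mul_of_one_le_right' hx
  have e1 : ∀ x, (f x * w x ^ (1 / q)) ^ q = f x ^ q * w x := fun x => by
    rw [ENNReal.mul_rpow_of_nonneg _ _ h0.le, ← ENNReal.rpow_mul, one_div_mul_cancel h0.ne',
      ENNReal.rpow_one]
  have e2 : ∀ x, (v x ^ ((q - 1) / q)) ^ (q / (q - 1)) = v x := fun x => by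
    rw [← ENNReal.rpow_mul, div_mul_div_cancel₀ h0.ne', div_self h1.ne', ENNReal.rpow_one]
  simp only [e1, e2] at hH
  refine (ENNReal.rpow_le_rpow (hle.trans hH) h0.le).trans (le_of_eq ?_)
  rw [ENNReal.mul_rpow_of_nonneg _ _ h0.le, ← ENNReal.rpow_mul, ← ENNReal.rpow_mul,
    one_div_mul_cancel h0.ne', ENNReal.rpow_one]
  congr 2
  field_simp

lemma lintegral_rpow_le_measure_univ_rpow_mul {α : Type*} [MeasurableSpace α] {ν : Measure α}
    {q : ℝ} (hq : 1 < q) {f : α → ℝ≥0∞} (hf : AEMeasurable f ν) :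
    (∫⁻ x, f x ∂ν) ^ q ≤ ν univ ^ (q - 1) * ∫⁻ x, f x ^ q ∂ν := by
  have := lintegral_rpow_le_of_weights hq hf (aemeasurable_const (b := 1))
    (aemeasurable_const (b := 1)) (Filter.Eventually.of_forall fun x => by simp)
  simpa [mul_comm] using this

lemma ennreal_rpow_sub_one_mul_self {x : ℝ≥0∞} (h : x ≠ 0) (h' : x ≠ ⊤) (q : ℝ) :
    x ^ (q - 1) * x = x ^ q := by
  nth_rewrite 2 [← ENNReal.rpow_one x]
  rw [← ENNReal.rpow_add _ _ h h', sub_add_cancel]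

lemma enorm_sub_mean_mul_le {α : Type*} [MeasurableSpace α] {ν : Measure α} [IsFiniteMeasure ν]
    {φ : α → ℝ} (hφ : Integrable φ ν) (a : ℝ) :
    ‖a - (∫ y, φ y ∂ν) / (ν univ).toReal‖ₑ * ν univ ≤ ∫⁻ y, ‖a - φ y‖ₑ ∂ν := by
  rcases eq_or_ne (ν univ) 0 with h | h
  · simp [h]
  have hpos : 0 < (ν univ).toReal := ENNReal.toReal_pos h (by finiteness)
  have h1 : ν univ = ‖(ν univ).toReal‖ₑ := by
    rw [Real.enorm_eq_ofReal hpos.le, ENNReal.ofReal_toReal (by finiteness)]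
  have h2 : (a - (∫ y, φ y ∂ν) / (ν univ).toReal) * (ν univ).toReal = ∫ y, (a - φ y) ∂ν := by
    rw [integral_sub (integrable_const a) hφ, integral_const, smul_eq_mul, measureReal_def]
    field_simp
  calc _ = ‖(a - (∫ y, φ y ∂ν) / (ν univ).toReal) * (ν univ).toReal‖ₑ := by
        rw [enorm_mul, ← h1]
    _ ≤ _ := by
        rw [h2]
        exact enorm_integral_le_lintegral_enorm _

lemma enorm_sub_mean_rpow_mul_le {α : Type*} [MeasurableSpace α] {ν : Measure α}
    [IsFiniteMeasure ν] {q : ℝ} (hq : 1 < q) {φ : α → ℝ} (hφ : Integrable φ ν) (a : ℝ) :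
    ‖a - (∫ y, φ y ∂ν) / (ν univ).toReal‖ₑ ^ q * ν univ ≤ ∫⁻ y, ‖a - φ y‖ₑ ^ q ∂ν := by
  rcases eq_or_ne (ν univ) 0 with h | h
  · simp [h]
  have h0 : 0 < q := by linarith
  have h1 : 0 < q - 1 := by linarith
  have hm : AEMeasurable (fun y => ‖a - φ y‖ₑ) ν :=
    (aestronglyMeasurable_const.sub hφ.aestronglyMeasurable).enorm
  have := (ENNReal.rpow_le_rpow (enorm_sub_mean_mul_le hφ a) h0.le).trans
    (lintegral_rpow_le_measure_univ_rpow_mul hq hm)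
  rw [ENNReal.mul_rpow_of_nonneg _ _ h0.le] at this
  rw [← ennreal_rpow_sub_one_mul_self h (by finiteness) q, mul_left_comm] at this
  refine (ENNReal.mul_le_mul_iff_right ?_ ?_).1 this
  · exact (ENNReal.rpow_pos (pos_iff_ne_zero.2 h) (by finiteness)).ne'
  · finiteness

/-- Replacing the mean by any other constant costs at most a factor `2 ^ q`. -/
lemma lintegral_enorm_sub_mean_rpow_le {α : Type*} [MeasurableSpace α] {ν : Measure α}
    [IsFiniteMeasure ν] {q : ℝ} (hq : 1 < q) {φ : α → ℝ} (hφ : Integrable φ ν) (a : ℝ) :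
    ∫⁻ x, ‖φ x - (∫ y, φ y ∂ν) / (ν univ).toReal‖ₑ ^ q ∂ν
      ≤ 2 ^ q * ∫⁻ x, ‖φ x - a‖ₑ ^ q ∂ν := by
  set A := (∫ y, φ y ∂ν) / (ν univ).toReal with hA
  have hmean := enorm_sub_mean_rpow_mul_le hq hφ a
  rw [← hA] at hmean
  have hm : AEMeasurable (fun y => ‖φ y - a‖ₑ ^ q) ν :=
    ((hφ.aestronglyMeasurable.sub aestronglyMeasurable_const).enorm).pow_const q
  calc _ ≤ ∫⁻ x, 2 ^ (q - 1) * (‖φ x - a‖ₑ ^ q + ‖a - A‖ₑ ^ q) ∂ν := by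
        refine lintegral_mono fun x => ?_
        refine le_trans ?_ (ENNReal.rpow_add_le_mul_rpow_add_rpow _ _ hq.le)
        gcongr
        rw [← sub_add_sub_cancel (φ x) a A]
        exact enorm_add_le _ _
    _ = 2 ^ (q - 1) * (∫⁻ x, ‖φ x - a‖ₑ ^ q ∂ν + ‖a - A‖ₑ ^ q * ν univ) := by
        rw [lintegral_const_mul' _ _ (by finiteness), lintegral_add_left' hm, lintegral_const]
    _ ≤ 2 ^ (q - 1) * (∫⁻ x, ‖φ x - a‖ₑ ^ q ∂ν + ∫⁻ x, ‖φ x - a‖ₑ ^ q ∂ν) := by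
        gcongr
        simpa only [enorm_sub_rev a] using hmean
    _ = _ := by
        rw [← two_mul, ← mul_assoc, ennreal_rpow_sub_one_mul_self (by norm_num) (by norm_num)]

lemma lintegral_comp_add_smul {n : ℕ} {f : En n → ℝ≥0∞} (hf : Measurable f) (p : En n) {t : ℝ}
    (ht : 0 < t) :
    ∫⁻ y, f (p + t • y) = ENNReal.ofReal (t ^ (-(n : ℝ))) * ∫⁻ z, f z := by
  have h1 : ∫⁻ y, f (p + t • y) = ∫⁻ z, f (p + z) ∂(Measure.map (t • ·) volume) := by
    rw [lintegral_map (by fun_prop) (by fun_prop)]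
  rw [h1, Measure.map_addHaar_smul volume ht.ne', lintegral_smul_measure,
    lintegral_add_left_eq_self f p, finrank_euclideanSpace_fin, abs_of_pos (by positivity),
    Real.rpow_neg ht.le, Real.rpow_natCast, smul_eq_mul]

/-- The segments from `x` into a convex set stay near `x` for small times. -/
lemma lintegral_comp_segment_le {n : ℕ} {g : En n → ℝ≥0∞} (hg : Measurable g) {xbar x : En n}
    {R t : ℝ} (hx : x ∈ ball xbar R) (ht : t ∈ Ioc (0 : ℝ) 1) :
    ∫⁻ y in ball xbar R, g (x + t • (y - x)) ≤
      ENNReal.ofReal (t ^ (-(n : ℝ))) *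
        ∫⁻ z in ball x (2 * R * t), (ball xbar R).indicator g z := by
  set h := (ball x (2 * R * t)).indicator ((ball xbar R).indicator g) with hh
  have hm : Measurable h := (hg.indicator measurableSet_ball).indicator measurableSet_ball
  rw [← lintegral_indicator measurableSet_ball ((ball xbar R).indicator g), ← hh,
    ← lintegral_comp_add_smul hm (x - t • x) ht.1, ← lintegral_indicator measurableSet_ball]
  refine lintegral_mono fun y => ?_
  by_cases hy : y ∈ ball xbar R
  · have e : x - t • x + t • y = x + t • (y - x) := by rw [smul_sub]; abel
    have h1 : x + t • (y - x) ∈ ball xbar R :=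
      (convex_ball xbar R).add_smul_sub_mem hx hy ⟨ht.1.le, ht.2⟩
    have h2 : x + t • (y - x) ∈ ball x (2 * R * t) := by
      rw [mem_ball, dist_eq_norm, add_sub_cancel_left, norm_smul, Real.norm_of_nonneg ht.1.le,
        mul_comm]
      refine mul_lt_mul_of_pos_right ?_ ht.1
      rw [← dist_eq_norm]
      have := dist_triangle_right y x xbar
      rw [mem_ball] at hx hy
      linarith
    rw [indicator_of_mem hy, e, hh, indicator_of_mem h2, indicator_of_mem h1]
  · rw [indicator_of_notMem hy]
    exact zero_le

lemma measurableSet_dist_lt_prod (n : ℕ) (ρ : ℝ) :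
    MeasurableSet {p : En n × En n | dist p.2 p.1 < ρ} :=
  measurableSet_lt (by fun_prop) measurable_const

lemma measurable_lintegral_ball {n : ℕ} {v : En n → ℝ≥0∞} (hv : Measurable v) (ρ : ℝ) :
    Measurable fun x => ∫⁻ z in ball x ρ, v z := by
  have h : Measurable ({p : En n × En n | dist p.2 p.1 < ρ}.indicator fun p => v p.2) :=
    (hv.comp measurable_snd).indicator (measurableSet_dist_lt_prod n ρ)
  have e : (fun x => ∫⁻ z in ball x ρ, v z) = fun x => ∫⁻ z,
      {p : En n × En n | dist p.2 p.1 < ρ}.indicator (fun p => v p.2) (x, z) := by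
    funext x
    rw [← lintegral_indicator measurableSet_ball]
    rfl
  rw [e]
  exact h.lintegral_prod_right'

lemma lintegral_mul_lintegral_ball_le {n : ℕ} {q : ℝ} (hq : 1 < q) {w v G : En n → ℝ≥0∞}
    (hw : Measurable w) (hv : Measurable v) (hG : Measurable G) {ρ : ℝ} {K : ℝ≥0∞}
    (hK : ∀ z, (∫⁻ x in ball z ρ, w x) * (∫⁻ x in ball z (2 * ρ), v x) ^ (q - 1) ≤ K) :
    ∫⁻ x, (∫⁻ z in ball x ρ, G z) * (∫⁻ z in ball x ρ, v z) ^ (q - 1) * w x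
      ≤ K * ∫⁻ z, G z := by
  set J : En n → ℝ≥0∞ := fun z => (∫⁻ x in ball z (2 * ρ), v x) ^ (q - 1) with hJ
  have hJm : Measurable J := (measurable_lintegral_ball hv _).pow_const _
  set F : En n × En n → ℝ≥0∞ := {p : En n × En n | dist p.2 p.1 < ρ}.indicator
    fun p => G p.2 * J p.2 * w p.1 with hF
  have hFm : Measurable F := by
    refine Measurable.indicator ?_ (measurableSet_dist_lt_prod n ρ)
    fun_prop
  calc _ ≤ ∫⁻ x, ∫⁻ z, F (x, z) := by
        refine lintegral_mono fun x => ?_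
        have e : ∫⁻ z, F (x, z) = ∫⁻ z in ball x ρ, G z * J z * w x := by
          rw [← lintegral_indicator measurableSet_ball]
          rfl
        rw [e, lintegral_mul_const _ (by fun_prop)]
        gcongr
        rw [← lintegral_mul_const _ hG]
        refine setLIntegral_mono (by fun_prop) fun z hz => ?_
        gcongr
        refine ENNReal.rpow_le_rpow (lintegral_mono_set ?_) (by linarith)
        refine ball_subset_ball' ?_
        rw [mem_ball, dist_comm] at hz
        linarith
    _ = ∫⁻ z, ∫⁻ x, F (x, z) := lintegral_lintegral_swap hFm.aemeasurable
    _ ≤ ∫⁻ z, K * G z := by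
        refine lintegral_mono fun z => ?_
        have e : ∫⁻ x, F (x, z) = ∫⁻ x in ball z ρ, G z * J z * w x := by
          rw [← lintegral_indicator measurableSet_ball]
          refine lintegral_congr fun x => ?_
          simp only [hF, indicator, mem_ofPred_eq, mem_ball, dist_comm z x]
        rw [e, lintegral_const_mul _ hw, mul_assoc, mul_comm (J z), mul_comm (G z)]
        gcongr
        exact hK z
    _ = _ := lintegral_const_mul _ hG

/-- The averaging operators along segments are uniformly bounded on `L^q(w)`. -/
lemma lintegral_segment_average_rpow_le {n : ℕ} {q : ℝ} (hq : 1 < q) {w v g : En n → ℝ≥0∞}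
    (hw : Measurable w) (hv : Measurable v) (hg : Measurable g)
    (hwv : ∀ᵐ x, 1 ≤ w x ^ (1 / q) * v x ^ ((q - 1) / q)) {K : ℝ≥0∞}
    (hA : ∀ (c : En n) (r : ℝ), 0 < r → (∫⁻ x in ball c r, w x) *
      (∫⁻ x in ball c r, v x) ^ (q - 1) ≤ K * ENNReal.ofReal (r ^ ((n : ℝ) * q)))
    (xbar : En n) {R : ℝ} (hR : 0 < R) {t : ℝ} (ht : t ∈ Ioc (0 : ℝ) 1) :
    ∫⁻ x in ball xbar R, (∫⁻ y in ball xbar R, g (x + t • (y - x))) ^ q * w x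
      ≤ K * ENNReal.ofReal ((4 * R) ^ ((n : ℝ) * q)) * ∫⁻ x in ball xbar R, g x ^ q * w x := by
  have h0 : 0 < q := by linarith
  have ht0 := ht.1
  set G : En n → ℝ≥0∞ := fun z => (ball xbar R).indicator g z ^ q * w z with hG
  have hgm : Measurable ((ball xbar R).indicator g) := hg.indicator measurableSet_ball
  have hGm : Measurable G := (hgm.pow_const q).mul hw
  have hGint : ∫⁻ z, G z = ∫⁻ x in ball xbar R, g x ^ q * w x := by
    rw [← lintegral_indicator measurableSet_ball]
    refine lintegral_congr fun z => ?_
    by_cases hz : z ∈ ball xbar R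
    · simp only [hG, indicator_of_mem hz]
    · simp only [hG, indicator_of_notMem hz, ENNReal.zero_rpow_of_pos h0, zero_mul]
  have hball := lintegral_mul_lintegral_ball_le hq hw hv hGm (ρ := 2 * R * t)
    (K := K * ENNReal.ofReal ((2 * (2 * R * t)) ^ ((n : ℝ) * q))) fun z => by
      refine le_trans ?_ (hA z (2 * (2 * R * t)) (by positivity))
      have : 0 < 2 * R * t := by positivity
      exact mul_le_mul_left (lintegral_mono_set (ball_subset_ball (by linarith))) _
  calc _ ≤ ∫⁻ x in ball xbar R, ENNReal.ofReal (t ^ (-(n : ℝ) * q)) *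
          ((∫⁻ z in ball x (2 * R * t), G z) *
            (∫⁻ z in ball x (2 * R * t), v z) ^ (q - 1) * w x) := by
        refine setLIntegral_mono ?_ fun x hx => ?_
        · have h1 := measurable_lintegral_ball hGm (2 * R * t)
          have h2 := measurable_lintegral_ball hv (2 * R * t)
          fun_prop
        rw [← mul_assoc]
        gcongr
        refine (ENNReal.rpow_le_rpow (lintegral_comp_segment_le hg hx ht) h0.le).trans ?_
        rw [ENNReal.mul_rpow_of_nonneg _ _ h0.le, ENNReal.ofReal_rpow_of_pos (by positivity),
          ← Real.rpow_mul ht0.le]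
        gcongr
        exact lintegral_rpow_le_of_weights hq hgm.aemeasurable hw.aemeasurable hv.aemeasurable
          (ae_restrict_of_ae hwv)
    _ ≤ ENNReal.ofReal (t ^ (-(n : ℝ) * q)) *
          (K * ENNReal.ofReal ((2 * (2 * R * t)) ^ ((n : ℝ) * q)) * ∫⁻ z, G z) := by
        rw [lintegral_const_mul' _ _ ENNReal.ofReal_ne_top]
        gcongr
        exact (setLIntegral_le_lintegral _ _).trans hball
    _ = _ := by
        rw [hGint, ← mul_assoc, mul_left_comm, ← ENNReal.ofReal_mul (by positivity)]
        congr 3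
        have e : 2 * (2 * R * t) = 4 * R * t := by ring
        rw [e, Real.mul_rpow (by positivity) ht0.le, mul_left_comm, ← Real.rpow_add ht0]
        simp

lemma enorm_sub_le_of_mem_ball {n : ℕ} {xbar x y : En n} {R : ℝ} (hx : x ∈ ball xbar R)
    (hy : y ∈ ball xbar R) : ‖y - x‖ₑ ≤ ENNReal.ofReal (2 * R) := by
  rw [← ofReal_norm, ← dist_eq_norm]
  refine ENNReal.ofReal_le_ofReal ?_
  have := dist_triangle_right y x xbar
  rw [mem_ball] at hx hy
  linarith

lemma integrableOn_ball_of_continuous {n : ℕ} {φ : En n → ℝ} (hφ : Continuous φ)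
    {ν : Measure (En n)} {xbar : En n} {R : ℝ} (hν : ν (ball xbar R) ≠ ⊤) : IntegrableOn φ (ball xbar R) ν := by
  obtain ⟨C, hC⟩ := (isCompact_closedBall xbar R).exists_bound_of_continuousOn hφ.continuousOn
  exact IntegrableOn.of_bound hν.lt_top hφ.aestronglyMeasurable C
    (ae_restrict_of_forall_mem measurableSet_ball fun x hx => hC x (ball_subset_closedBall hx))

/-- A Poincaré inequality for Muckenhoupt weights. -/
lemma exists_lintegral_enorm_sub_rpow_le_of_muckenhoupt {n : ℕ} {q : ℝ} (hq : 1 < q)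
    {w v : En n → ℝ≥0∞} (hw : Measurable w) (hv : Measurable v)
    (hwv : ∀ᵐ x, 1 ≤ w x ^ (1 / q) * v x ^ ((q - 1) / q)) {K : ℝ≥0∞}
    (hA : ∀ (c : En n) (r : ℝ), 0 < r → (∫⁻ x in ball c r, w x) *
      (∫⁻ x in ball c r, v x) ^ (q - 1) ≤ K * ENNReal.ofReal (r ^ ((n : ℝ) * q)))
    (xbar : En n) {R : ℝ} (hR : 0 < R) {φ : En n → ℝ} (hφ : ContDiff ℝ 1 φ) :
    ∃ a : ℝ, ∫⁻ x in ball xbar R, ‖φ x - a‖ₑ ^ q * w x ≤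
      K * ENNReal.ofReal (2 ^ q * 4 ^ ((n : ℝ) * q)) * (volume (ball (0 : En n) 1) ^ q)⁻¹ *
        ENNReal.ofReal (R ^ q) * ∫⁻ x in ball xbar R, ‖fderiv ℝ φ x‖ₑ ^ q * w x := by
  have h0 : 0 < q := by linarith
  set B := ball xbar R with hB
  set g : En n → ℝ≥0∞ := fun z => ‖fderiv ℝ φ z‖ₑ with hg
  have hgm : Measurable g := (hφ.continuous_fderiv one_ne_zero).measurable.enorm
  set V := volume B with hV
  have hV0 : V ≠ 0 := (measure_ball_pos volume xbar hR).ne'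
  have hVt : V ≠ ⊤ := measure_ball_lt_top.ne
  have : IsFiniteMeasure (volume.restrict B) := ⟨by simpa using hVt.lt_top⟩
  set A : ℝ → En n → ℝ≥0∞ := fun t x => ∫⁻ y in B, g (x + t • (y - x)) with hAdef
  have hAm : Measurable (fun p : En n × ℝ => A p.2 p.1) := by
    have h1 : Measurable fun p : (En n × ℝ) × En n => g (p.1.1 + p.1.2 • (p.2 - p.1.1)) :=
      hgm.comp (by fun_prop)
    exact h1.lintegral_prod_right'
  have hAt : ∀ x, Measurable fun t => A t x := fun x => by
    have h1 : Measurable fun p : ℝ × En n => g (x + p.1 • (p.2 - x)) := hgm.comp (by fun_prop)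
    exact h1.lintegral_prod_right'
  set a := (∫ y in B, φ y) / V.toReal with ha
  refine ⟨a, ?_⟩
  have hpt : ∀ x ∈ B, ‖φ x - a‖ₑ ^ q * V ^ q ≤
      ENNReal.ofReal (2 * R) ^ q * ∫⁻ t in Ioc (0 : ℝ) 1, A t x ^ q := by
    intro x hx
    have h1 : ‖φ x - a‖ₑ * V ≤ ∫⁻ y in B, ‖φ x - φ y‖ₑ := by
      have := enorm_sub_mean_mul_le (integrableOn_ball_of_continuous hφ.continuous hVt) (φ x)
      simpa only [Measure.restrict_apply_univ] using this
    have h2 : ∫⁻ y in B, ‖φ x - φ y‖ₑ ≤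
        ENNReal.ofReal (2 * R) * ∫⁻ t in Ioc (0 : ℝ) 1, A t x := by
      calc _ ≤ ∫⁻ y in B, ENNReal.ofReal (2 * R) *
              ∫⁻ t in Ioc (0 : ℝ) 1, g (x + t • (y - x)) := by
            refine setLIntegral_mono' measurableSet_ball fun y hy => ?_
            rw [enorm_sub_rev]
            refine (enorm_sub_le_lintegral_fderiv hφ x y).trans ?_
            gcongr
            exact enorm_sub_le_of_mem_ball hx hy
        _ = _ := by
            rw [lintegral_const_mul' _ _ ENNReal.ofReal_ne_top, lintegral_lintegral_swap]
            have : Measurable fun p : En n × ℝ => g (x + p.2 • (p.1 - x)) :=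
              hgm.comp (by fun_prop)
            exact this.aemeasurable
    have h3 := lintegral_rpow_le_measure_univ_rpow_mul (ν := volume.restrict (Ioc (0 : ℝ) 1)) hq
      (f := fun t => A t x) (hAt x).aemeasurable
    simp only [Measure.restrict_apply_univ, Real.volume_Ioc, sub_zero, ENNReal.ofReal_one,
      ENNReal.one_rpow, one_mul] at h3
    rw [← ENNReal.mul_rpow_of_nonneg _ _ h0.le]
    refine (ENNReal.rpow_le_rpow (h1.trans h2) h0.le).trans ?_
    rw [ENNReal.mul_rpow_of_nonneg _ _ h0.le]
    gcongr
  have hbound : (∫⁻ x in B, ‖φ x - a‖ₑ ^ q * w x) * V ^ q ≤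
      ENNReal.ofReal (2 * R) ^ q * (K * ENNReal.ofReal ((4 * R) ^ ((n : ℝ) * q)) *
        ∫⁻ x in B, g x ^ q * w x) := by
    have hm : Measurable fun p : En n × ℝ => A p.2 p.1 ^ q * w p.1 :=
      (hAm.pow_const q).mul (hw.comp measurable_fst)
    calc _ = ∫⁻ x in B, ‖φ x - a‖ₑ ^ q * V ^ q * w x := by
          rw [← lintegral_mul_const' _ _ (by finiteness)]
          refine lintegral_congr fun x => ?_
          ring
      _ ≤ ∫⁻ x in B, ENNReal.ofReal (2 * R) ^ q *
            ∫⁻ t in Ioc (0 : ℝ) 1, A t x ^ q * w x := by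
          refine setLIntegral_mono' measurableSet_ball fun x hx => ?_
          rw [lintegral_mul_const _ ((hAt x).pow_const q), ← mul_assoc]
          exact mul_le_mul' (hpt x hx) le_rfl
      _ = ENNReal.ofReal (2 * R) ^ q * ∫⁻ t in Ioc (0 : ℝ) 1, ∫⁻ x in B, A t x ^ q * w x := by
          rw [lintegral_const_mul' _ _ (by finiteness)]
          exact congrArg _ (lintegral_lintegral_swap (μ := volume.restrict B)
            (ν := volume.restrict (Ioc (0 : ℝ) 1)) (f := fun x t => A t x ^ q * w x)
            hm.aemeasurable)
      _ ≤ ENNReal.ofReal (2 * R) ^ q * ∫⁻ _t in Ioc (0 : ℝ) 1,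
            (K * ENNReal.ofReal ((4 * R) ^ ((n : ℝ) * q)) * ∫⁻ x in B, g x ^ q * w x) := by
          gcongr 1
          exact setLIntegral_mono' measurableSet_Ioc fun t ht =>
            lintegral_segment_average_rpow_le hq hw hv hgm hwv hA xbar hR ht
      _ = _ := by simp
  refine (ENNReal.mul_le_mul_iff_left (ENNReal.rpow_pos (pos_iff_ne_zero.2 hV0) hVt).ne'
    (by finiteness : V ^ q ≠ ⊤)).1 (hbound.trans (le_of_eq ?_))
  have hV1 : volume (ball (0 : En n) 1) ≠ 0 := (measure_ball_pos volume _ one_pos).ne'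
  have hVq : V ^ q = ENNReal.ofReal (R ^ ((n : ℝ) * q)) * volume (ball (0 : En n) 1) ^ q := by
    rw [hV, hB, volume_ball_eq xbar hR, ENNReal.mul_rpow_of_nonneg _ _ h0.le,
      ENNReal.ofReal_rpow_of_pos (by positivity), ← Real.rpow_mul hR.le]
  have hcancel : (volume (ball (0 : En n) 1) ^ q)⁻¹ * volume (ball (0 : En n) 1) ^ q = 1 :=
    ENNReal.inv_mul_cancel (ENNReal.rpow_pos (pos_iff_ne_zero.2 hV1) (by finiteness)).ne'
      (by finiteness)
  rw [hVq, ENNReal.ofReal_rpow_of_pos (by positivity), Real.mul_rpow (by norm_num) hR.le,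
    Real.mul_rpow (by norm_num) hR.le, ENNReal.ofReal_mul (by positivity),
    ENNReal.ofReal_mul (by positivity), ENNReal.ofReal_mul (by positivity)]
  calc _ = K * (ENNReal.ofReal (2 ^ q) * ENNReal.ofReal (4 ^ ((n : ℝ) * q))) * 1 *
        ENNReal.ofReal (R ^ q) * (∫⁻ x in B, g x ^ q * w x) *
          ENNReal.ofReal (R ^ ((n : ℝ) * q)) := by ring
    _ = _ := by rw [← hcancel]; ring

lemma lintegral_lintegral_comp_segment_le {n : ℕ} {H : En n → ℝ≥0∞} (hH : Measurable H)
    (S T : Set (En n)) {t : ℝ} (ht : t ∈ Ioc (0 : ℝ) 1) {V : ℝ≥0∞} (hS : volume S ≤ V)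
    (hT : volume T ≤ V) :
    ∫⁻ x in S, ∫⁻ y in T, H (x + t • (y - x)) ≤ ENNReal.ofReal (2 ^ (n : ℝ)) * V * ∫⁻ z, H z := by
  have hpow : ∀ s : ℝ, 1 / 2 ≤ s →
      ENNReal.ofReal (s ^ (-(n : ℝ))) ≤ ENNReal.ofReal (2 ^ (n : ℝ)) := by
    intro s hs
    refine ENNReal.ofReal_le_ofReal ?_
    have : (2 : ℝ) ^ (n : ℝ) = (1 / 2 : ℝ) ^ (-(n : ℝ)) := by
      rw [Real.rpow_neg (by norm_num), ← Real.inv_rpow (by norm_num)]; norm_num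
    rw [this]
    exact Real.rpow_le_rpow_of_nonpos (by norm_num) hs (by simp)
  rcases le_or_gt (1 / 2) t with h | h
  · calc _ ≤ ∫⁻ _x in S, ENNReal.ofReal (2 ^ (n : ℝ)) * ∫⁻ z, H z := by
          refine lintegral_mono fun x => ?_
          refine (setLIntegral_le_lintegral _ _).trans ?_
          have e : ∀ y, x + t • (y - x) = x - t • x + t • y := fun y => by rw [smul_sub]; abel
          simp only [e]
          rw [lintegral_comp_add_smul hH _ ht.1]
          exact mul_le_mul' (hpow t h) le_rfl
      _ ≤ _ := by
          rw [setLIntegral_const, mul_right_comm]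
          gcongr
  · have hm : Measurable fun p : En n × En n => H (p.1 + t • (p.2 - p.1)) :=
      hH.comp (by fun_prop)
    rw [lintegral_lintegral_swap hm.aemeasurable]
    calc _ ≤ ∫⁻ _y in T, ENNReal.ofReal (2 ^ (n : ℝ)) * ∫⁻ z, H z := by
          refine lintegral_mono fun y => ?_
          refine (setLIntegral_le_lintegral _ _).trans ?_
          have e : ∀ x, x + t • (y - x) = t • y + (1 - t) • x := fun x => by
            rw [smul_sub, sub_smul, one_smul]; abel
          simp only [e]
          rw [lintegral_comp_add_smul hH _ (show 0 < 1 - t by linarith)]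
          exact mul_le_mul' (hpow (1 - t) (by linarith)) le_rfl
      _ ≤ _ := by
          rw [setLIntegral_const, mul_right_comm]
          gcongr

/-- A Poincaré inequality between two sets such that the weight does not decrease much along the
segments joining them. -/
lemma lintegral_enorm_sub_mean_rpow_mul_le {n : ℕ} {q : ℝ} (hq : 1 < q) {w : En n → ℝ≥0∞}
    (hw : Measurable w) {xbar : En n} {R : ℝ} {S T : Set (En n)}
    (hSm : MeasurableSet S) (hTm : MeasurableSet T) (hS : S ⊆ ball xbar R)
    (hT : T ⊆ ball xbar R) {K : ℝ≥0∞}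
    (hK : ∀ x ∈ S, ∀ y ∈ T, ∀ t ∈ Ioc (0 : ℝ) 1, w x ≤ K * w (x + t • (y - x)))
    {φ : En n → ℝ} (hφ : ContDiff ℝ 1 φ) :
    (∫⁻ x in S, ‖φ x - (∫ y in T, φ y) / (volume T).toReal‖ₑ ^ q * w x) * volume T ≤
      ENNReal.ofReal (2 * R) ^ q * (K * (ENNReal.ofReal (2 ^ (n : ℝ)) * volume (ball xbar R) *
        ∫⁻ x in ball xbar R, ‖fderiv ℝ φ x‖ₑ ^ q * w x)) := by
  have h0 : 0 < q := by linarith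
  have hTt : volume T ≠ ⊤ := ((measure_mono hT).trans_lt measure_ball_lt_top).ne
  have : IsFiniteMeasure (volume.restrict T) := ⟨by simpa using hTt.lt_top⟩
  have hφT : IntegrableOn φ T :=
    (integrableOn_ball_of_continuous hφ.continuous measure_ball_lt_top.ne).mono_set hT
  set g : En n → ℝ≥0∞ := fun z => ‖fderiv ℝ φ z‖ₑ with hg
  have hgm : Measurable g := (hφ.continuous_fderiv one_ne_zero).measurable.enorm
  set H : En n → ℝ≥0∞ := (ball xbar R).indicator fun z => g z ^ q * w z with hH
  have hHm : Measurable H := ((hgm.pow_const q).mul hw).indicator measurableSet_ball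
  have hHint : ∫⁻ z, H z = ∫⁻ x in ball xbar R, g x ^ q * w x :=
    lintegral_indicator measurableSet_ball _
  have hpt : ∀ x ∈ S, ∀ y ∈ T, ‖φ x - φ y‖ₑ ^ q * w x ≤
      ENNReal.ofReal (2 * R) ^ q * ∫⁻ t in Ioc (0 : ℝ) 1, K * H (x + t • (y - x)) := by
    intro x hx y hy
    have hgt : Measurable fun t : ℝ => g (x + t • (y - x)) := hgm.comp (by fun_prop)
    have h1 : ‖φ x - φ y‖ₑ ≤
        ENNReal.ofReal (2 * R) * ∫⁻ t in Ioc (0 : ℝ) 1, g (x + t • (y - x)) := by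
      rw [enorm_sub_rev]
      refine (enorm_sub_le_lintegral_fderiv hφ x y).trans ?_
      gcongr
      exact enorm_sub_le_of_mem_ball (hS hx) (hT hy)
    have h2 := lintegral_rpow_le_measure_univ_rpow_mul (ν := volume.restrict (Ioc (0 : ℝ) 1)) hq
      hgt.aemeasurable
    simp only [Measure.restrict_apply_univ, Real.volume_Ioc, sub_zero, ENNReal.ofReal_one,
      ENNReal.one_rpow, one_mul] at h2
    calc _ ≤ (ENNReal.ofReal (2 * R) ^ q *
            ∫⁻ t in Ioc (0 : ℝ) 1, g (x + t • (y - x)) ^ q) * w x := by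
          gcongr
          refine (ENNReal.rpow_le_rpow h1 h0.le).trans ?_
          rw [ENNReal.mul_rpow_of_nonneg _ _ h0.le]
          gcongr
      _ = ENNReal.ofReal (2 * R) ^ q *
            ∫⁻ t in Ioc (0 : ℝ) 1, g (x + t • (y - x)) ^ q * w x := by
          rw [lintegral_mul_const _ (hgt.pow_const q), mul_assoc]
      _ ≤ _ := by
          gcongr 1
          refine setLIntegral_mono' measurableSet_Ioc fun t ht => ?_
          have hz : x + t • (y - x) ∈ ball xbar R :=
            (convex_ball xbar R).add_smul_sub_mem (hS hx) (hT hy) ⟨ht.1.le, ht.2⟩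
          rw [hH, indicator_of_mem hz, mul_left_comm]
          gcongr
          exact hK x hx y hy t ht
  have hm3 : Measurable fun p : (En n × En n) × ℝ => H (p.1.1 + p.2 • (p.1.2 - p.1.1)) :=
    hHm.comp (by fun_prop)
  have hm2 : ∀ x, Measurable fun p : En n × ℝ => H (x + p.2 • (p.1 - x)) := fun x =>
    hHm.comp (by fun_prop)
  have hm2' : Measurable fun p : En n × ℝ => ∫⁻ y in T, H (p.1 + p.2 • (y - p.1)) := by
    have : Measurable fun p : (En n × ℝ) × En n => H (p.1.1 + p.1.2 • (p.2 - p.1.1)) :=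
      hHm.comp (by fun_prop)
    exact this.lintegral_prod_right'
  have hm1 : ∀ x y, Measurable fun t : ℝ => H (x + t • (y - x)) := fun x y =>
    hHm.comp (by fun_prop)
  have hmy : ∀ x, Measurable fun y => ∫⁻ t in Ioc (0 : ℝ) 1, H (x + t • (y - x)) := fun x =>
    (hm2 x).lintegral_prod_right'
  have hmx : Measurable fun x => ∫⁻ y in T, ∫⁻ t in Ioc (0 : ℝ) 1, H (x + t • (y - x)) :=
    Measurable.lintegral_prod_right' (f := fun p : En n × En n =>
      ∫⁻ t in Ioc (0 : ℝ) 1, H (p.1 + t • (p.2 - p.1))) hm3.lintegral_prod_right'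
  have hφm : Measurable φ := hφ.continuous.measurable
  calc _ = ∫⁻ x in S, ‖φ x - (∫ y in T, φ y) / (volume T).toReal‖ₑ ^ q * volume T * w x := by
        rw [← lintegral_mul_const' _ _ hTt]
        refine lintegral_congr fun x => ?_
        ring
    _ ≤ ∫⁻ x in S, ∫⁻ y in T, ‖φ x - φ y‖ₑ ^ q * w x := by
        refine lintegral_mono fun x => ?_
        rw [lintegral_mul_const _ (by fun_prop)]
        gcongr
        have := enorm_sub_mean_rpow_mul_le hq hφT (φ x)
        simpa only [Measure.restrict_apply_univ] using this
    _ ≤ ∫⁻ x in S, ∫⁻ y in T, ENNReal.ofReal (2 * R) ^ q *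
          ∫⁻ t in Ioc (0 : ℝ) 1, K * H (x + t • (y - x)) :=
        setLIntegral_mono' hSm fun x hx => setLIntegral_mono' hTm fun y hy => hpt x hx y hy
    _ = ENNReal.ofReal (2 * R) ^ q * (K * ∫⁻ x in S, ∫⁻ y in T,
          ∫⁻ t in Ioc (0 : ℝ) 1, H (x + t • (y - x))) := by
        rw [← lintegral_const_mul _ hmx, ← lintegral_const_mul' _ _ (by finiteness)]
        refine lintegral_congr fun x => ?_
        rw [lintegral_const_mul' _ _ (by finiteness), ← lintegral_const_mul _ (hmy x)]
        congr 1
        refine lintegral_congr fun y => ?_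
        rw [lintegral_const_mul _ (hm1 x y)]
    _ = ENNReal.ofReal (2 * R) ^ q * (K * ∫⁻ t in Ioc (0 : ℝ) 1, ∫⁻ x in S, ∫⁻ y in T,
          H (x + t • (y - x))) := by
        rw [← lintegral_lintegral_swap (μ := volume.restrict S)
          (ν := volume.restrict (Ioc (0 : ℝ) 1))
          (f := fun x t => ∫⁻ y in T, H (x + t • (y - x))) hm2'.aemeasurable]
        congr 2
        refine lintegral_congr fun x => ?_
        rw [lintegral_lintegral_swap (hm2 x).aemeasurable]
    _ ≤ ENNReal.ofReal (2 * R) ^ q * (K * ∫⁻ _t in Ioc (0 : ℝ) 1,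
          ENNReal.ofReal (2 ^ (n : ℝ)) * volume (ball xbar R) * ∫⁻ z, H z) := by
        gcongr 2
        exact setLIntegral_mono' measurableSet_Ioc fun t ht =>
          lintegral_lintegral_comp_segment_le hHm S T ht (measure_mono hS) (measure_mono hT)
    _ = _ := by
        rw [setLIntegral_const, Real.volume_Ioc, hHint, sub_zero, ENNReal.ofReal_one, mul_one]

lemma lintegral_enorm_sub_mean_rpow_le_of_volume_le {n : ℕ} {q : ℝ} (hq : 1 < q)
    {w : En n → ℝ≥0∞} (hw : Measurable w) {xbar : En n} {R : ℝ} {S T : Set (En n)}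
    (hSm : MeasurableSet S) (hTm : MeasurableSet T) (hS : S ⊆ ball xbar R)
    (hT : T ⊆ ball xbar R) (hT0 : volume T ≠ 0) {K M : ℝ≥0∞}
    (hM : volume (ball xbar R) ≤ M * volume T)
    (hK : ∀ x ∈ S, ∀ y ∈ T, ∀ t ∈ Ioc (0 : ℝ) 1, w x ≤ K * w (x + t • (y - x)))
    {φ : En n → ℝ} (hφ : ContDiff ℝ 1 φ) :
    ∫⁻ x in S, ‖φ x - (∫ y in T, φ y) / (volume T).toReal‖ₑ ^ q * w x ≤
      ENNReal.ofReal (2 * R) ^ q * (K * (ENNReal.ofReal (2 ^ (n : ℝ)) * M *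
        ∫⁻ x in ball xbar R, ‖fderiv ℝ φ x‖ₑ ^ q * w x)) := by
  have hTt : volume T ≠ ⊤ := ((measure_mono hT).trans_lt measure_ball_lt_top).ne
  refine (ENNReal.mul_le_mul_iff_left hT0 hTt).1
    ((lintegral_enorm_sub_mean_rpow_mul_le hq hw hSm hTm hS hT hK hφ).trans ?_)
  calc _ ≤ ENNReal.ofReal (2 * R) ^ q * (K * (ENNReal.ofReal (2 ^ (n : ℝ)) * (M * volume T) *
        ∫⁻ x in ball xbar R, ‖fderiv ℝ φ x‖ₑ ^ q * w x)) := by gcongr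
    _ = _ := by ring

lemma norm_le_mul_norm_segment {n : ℕ} {f x y : En n} {R t : ℝ} (hf : ‖f‖ = 1)
    (hx : 0 ≤ inner ℝ f x) (hy : R / 4 ≤ inner ℝ f y) (hxR : ‖x‖ ≤ 3 * R) (hyR : ‖y‖ ≤ 3 * R)
    (ht : t ∈ Ioc (0 : ℝ) 1) : ‖x‖ ≤ 25 * ‖x + t • (y - x)‖ := by
  obtain ⟨ht0, ht1⟩ := ht
  have h1 : inner ℝ f (x + t • (y - x)) = (1 - t) * inner ℝ f x + t * inner ℝ f y := by
    rw [inner_add_right, inner_smul_right, inner_sub_right]; ring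
  have h2 : inner ℝ f (x + t • (y - x)) ≤ ‖x + t • (y - x)‖ := by
    simpa [hf] using real_inner_le_norm f (x + t • (y - x))
  have h3 : ‖x‖ ≤ ‖x + t • (y - x)‖ + t * ‖y - x‖ := by
    have := norm_sub_le (x + t • (y - x)) (t • (y - x))
    rwa [add_sub_cancel_right, norm_smul, Real.norm_of_nonneg ht0.le] at this
  have h4 : ‖y - x‖ ≤ 6 * R := (norm_sub_le y x).trans (by linarith)
  have h5 := mul_nonneg (sub_nonneg.2 ht1) hx
  have h6 := mul_le_mul_of_nonneg_left hy ht0.le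
  have h7 := mul_le_mul_of_nonneg_left h4 ht0.le
  linarith

lemma ofReal_norm_rpow_le {n : ℕ} {θ k : ℝ} (hθ : 0 ≤ θ) (hk : 0 ≤ k) {x z : En n}
    (h : ‖x‖ ≤ k * ‖z‖) :
    ENNReal.ofReal (‖x‖ ^ θ) ≤ ENNReal.ofReal (k ^ θ) * ENNReal.ofReal (‖z‖ ^ θ) := by
  rw [← ENNReal.ofReal_mul (by positivity), ← Real.mul_rpow hk (norm_nonneg z)]
  gcongr

lemma measurable_ofReal_norm_rpow (n : ℕ) (θ : ℝ) :
    Measurable fun x : En n => ENNReal.ofReal (‖x‖ ^ θ) := by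
  fun_prop

lemma volume_ball_eq_mul_volume_ball_div_four {n : ℕ} (c e : En n) {R : ℝ} (hR : 0 < R) :
    volume (ball c R) = ENNReal.ofReal (4 ^ (n : ℝ)) * volume (ball e (R / 4)) := by
  rw [volume_ball_eq c hR, volume_ball_eq e (by positivity), ← mul_assoc,
    ← ENNReal.ofReal_mul (by positivity), ← Real.mul_rpow (by norm_num) (by positivity)]
  congr 4
  ring

lemma norm_le_of_mem_ball_of_norm_lt {n : ℕ} {xbar x : En n} {R : ℝ} (hc : ‖xbar‖ < 2 * R)
    (hx : x ∈ ball xbar R) : ‖x‖ ≤ 3 * R := by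
  have h1 := norm_le_norm_add_norm_sub' x xbar
  rw [mem_ball_iff_norm] at hx
  linarith

lemma inner_sub_lt_inner_of_mem_ball {n : ℕ} {f e y : En n} {r : ℝ} (hf : ‖f‖ = 1)
    (hy : y ∈ ball e r) : inner ℝ f e - r < inner ℝ f y := by
  have h1 : inner ℝ f (e - y) ≤ ‖e - y‖ := by simpa [hf] using real_inner_le_norm f (e - y)
  rw [inner_sub_right] at h1
  rw [mem_ball_iff_norm'] at hy
  linarith

lemma lintegral_halfSpace_enorm_sub_mean_rpow_le {n : ℕ} {q : ℝ} (hq : 1 < q) {θ : ℝ}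
    (hθ : 0 ≤ θ) {xbar f e : En n} {R : ℝ} (hR : 0 < R) (hc : ‖xbar‖ < 2 * R) (hf : ‖f‖ = 1)
    (he : ‖e‖ ≤ 3 * R / 4) (hfe : R / 2 ≤ inner ℝ f (xbar + e)) {φ : En n → ℝ}
    (hφ : ContDiff ℝ 1 φ) :
    ∫⁻ x in ball xbar R ∩ {x | 0 ≤ inner ℝ f x},
        ‖φ x - (∫ y in ball (xbar + e) (R / 4), φ y) /
          (volume (ball (xbar + e) (R / 4))).toReal‖ₑ ^ q * ENNReal.ofReal (‖x‖ ^ θ) ≤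
      ENNReal.ofReal (2 * R) ^ q * (ENNReal.ofReal (25 ^ θ) * (ENNReal.ofReal (2 ^ (n : ℝ)) *
        ENNReal.ofReal (4 ^ (n : ℝ)) *
          ∫⁻ x in ball xbar R, ‖fderiv ℝ φ x‖ₑ ^ q * ENNReal.ofReal (‖x‖ ^ θ))) := by
  have hTB : ball (xbar + e) (R / 4) ⊆ ball xbar R := by
    refine ball_subset_ball' ?_
    rw [dist_eq_norm, add_sub_cancel_left]
    linarith
  refine lintegral_enorm_sub_mean_rpow_le_of_volume_le hq (measurable_ofReal_norm_rpow n θ)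
    (measurableSet_ball.inter (measurableSet_le measurable_const (by fun_prop)))
    measurableSet_ball inter_subset_left hTB
    (measure_ball_pos volume _ (by positivity)).ne'
    (volume_ball_eq_mul_volume_ball_div_four xbar (xbar + e) hR).le (fun x hx y hy t ht => ?_) hφ
  refine ofReal_norm_rpow_le hθ (by norm_num) (norm_le_mul_norm_segment hf hx.2 ?_
    (norm_le_of_mem_ball_of_norm_lt hc hx.1) (norm_le_of_mem_ball_of_norm_lt hc (hTB hy)) ht)
  have := inner_sub_lt_inner_of_mem_ball hf hy
  linarith

lemma enorm_sub_rpow_le_mul_add {q : ℝ} (hq : 1 < q) (a b c : ℝ) :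
    ‖a - c‖ₑ ^ q ≤ 2 ^ (q - 1) * (‖a - b‖ₑ ^ q + ‖b - c‖ₑ ^ q) := by
  refine le_trans ?_ (ENNReal.rpow_add_le_mul_rpow_add_rpow _ _ hq.le)
  gcongr
  rw [← sub_add_sub_cancel a b c]
  exact enorm_add_le _ _

/-- A one-sided Poincaré inequality for the weight `‖x‖ ^ θ`, with a constant that does not depend
on the side. -/
lemma lintegral_halfSpace_enorm_sub_rpow_le {n : ℕ} {q : ℝ} (hq : 1 < q) {θ : ℝ}
    (hθ : 0 ≤ θ) {xbar u v : En n} {R : ℝ} (hR : 0 < R) (hc : ‖xbar‖ < 2 * R) (hu : ‖u‖ = 1)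
    (hv : ‖v‖ = 1) (huv : inner ℝ u v = 0) (hux : inner ℝ u xbar = 0)
    (hvx : 0 ≤ inner ℝ v xbar) {φ : En n → ℝ} (hφ : ContDiff ℝ 1 φ) :
    ∫⁻ x in ball xbar R ∩ {x | 0 ≤ inner ℝ u x},
        ‖φ x - (∫ y in ball (xbar + (R / 2) • v) (R / 4), φ y) /
          (volume (ball (xbar + (R / 2) • v) (R / 4))).toReal‖ₑ ^ q * ENNReal.ofReal (‖x‖ ^ θ) ≤
      2 ^ (q - 1) * (1 + ENNReal.ofReal (12 ^ θ) * ENNReal.ofReal (4 ^ (n : ℝ))) *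
      (ENNReal.ofReal (2 * R) ^ q * (ENNReal.ofReal (25 ^ θ) * (ENNReal.ofReal (2 ^ (n : ℝ)) *
        ENNReal.ofReal (4 ^ (n : ℝ)) *
          ∫⁻ x in ball xbar R, ‖fderiv ℝ φ x‖ₑ ^ q * ENNReal.ofReal (‖x‖ ^ θ)))) := by
  have h0 : 0 < q := by linarith
  have hvv : inner ℝ v v = 1 := by rw [real_inner_self_eq_norm_sq, hv, one_pow]
  have huu : inner ℝ u u = 1 := by rw [real_inner_self_eq_norm_sq, hu, one_pow]
  have hvu : inner ℝ v u = 0 := by rw [real_inner_comm]; exact huv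
  have hR2 : ‖(R / 2) • v‖ = R / 2 := by
    rw [norm_smul, hv, Real.norm_of_nonneg (by positivity), mul_one]
  have hE := lintegral_halfSpace_enorm_sub_mean_rpow_le hq hθ hR hc hv (e := (R / 2) • v)
    (by rw [hR2]; linarith) (by rw [inner_add_right, inner_smul_right, hvv]; linarith) hφ
  have he : ‖(R / 2) • u + (R / 4) • v‖ ≤ 3 * R / 4 := by
    refine (norm_add_le _ _).trans ?_
    rw [norm_smul, norm_smul, hu, hv, Real.norm_of_nonneg (by positivity),
      Real.norm_of_nonneg (by positivity)]
    linarith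
  have hue : inner ℝ u (xbar + ((R / 2) • u + (R / 4) • v)) = R / 2 := by
    simp only [inner_add_right, inner_smul_right, huu, huv, hux]; ring
  have hve : R / 4 ≤ inner ℝ v (xbar + ((R / 2) • u + (R / 4) • v)) := by
    simp only [inner_add_right, inner_smul_right, hvv, hvu]; linarith
  have hF := lintegral_halfSpace_enorm_sub_mean_rpow_le hq hθ hR hc hu he hue.ge hφ
  set Q := ENNReal.ofReal (2 * R) ^ q * (ENNReal.ofReal (25 ^ θ) * (ENNReal.ofReal (2 ^ (n : ℝ)) *
    ENNReal.ofReal (4 ^ (n : ℝ)) *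
      ∫⁻ x in ball xbar R, ‖fderiv ℝ φ x‖ₑ ^ q * ENNReal.ofReal (‖x‖ ^ θ)))
  set c₀ := (∫ y in ball (xbar + (R / 2) • v) (R / 4), φ y) /
    (volume (ball (xbar + (R / 2) • v) (R / 4))).toReal
  set T := ball (xbar + ((R / 2) • u + (R / 4) • v)) (R / 4) with hT
  set c₁ := (∫ y in T, φ y) / (volume T).toReal with hc₁
  have hTB : T ⊆ ball xbar R := by
    refine ball_subset_ball' ?_
    rw [dist_eq_norm, add_sub_cancel_left]
    linarith
  have hTt : volume T ≠ ⊤ := measure_ball_lt_top.ne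
  have : IsFiniteMeasure (volume.restrict T) := ⟨by simpa using hTt.lt_top⟩
  have hmean : ENNReal.ofReal ((R / 4) ^ θ) * (‖c₁ - c₀‖ₑ ^ q * volume T) ≤ Q := by
    have h1 := enorm_sub_mean_rpow_mul_le hq (integrableOn_ball_of_continuous hφ.continuous hTt) c₀
    rw [Measure.restrict_apply_univ, ← hc₁, enorm_sub_rev] at h1
    calc _ ≤ ENNReal.ofReal ((R / 4) ^ θ) * ∫⁻ y in T, ‖c₀ - φ y‖ₑ ^ q := by gcongr
      _ = ∫⁻ y in T, ‖φ y - c₀‖ₑ ^ q * ENNReal.ofReal ((R / 4) ^ θ) := by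
          rw [← lintegral_const_mul' _ _ ENNReal.ofReal_ne_top]
          refine lintegral_congr fun y => ?_
          rw [enorm_sub_rev, mul_comm]
      _ ≤ ∫⁻ y in T, ‖φ y - c₀‖ₑ ^ q * ENNReal.ofReal (‖y‖ ^ θ) := by
          refine setLIntegral_mono' measurableSet_ball fun y hy => ?_
          have h2 := inner_sub_lt_inner_of_mem_ball hu hy
          have h3 : inner ℝ u y ≤ ‖y‖ := by simpa [hu] using real_inner_le_norm u y
          have h4 : R / 4 ≤ ‖y‖ := by linarith
          gcongr
      _ ≤ _ := by
          have hsub : T ⊆ ball xbar R ∩ {x | 0 ≤ inner ℝ v x} := fun y hy =>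
            ⟨hTB hy, by
              have := inner_sub_lt_inner_of_mem_ball hv hy
              exact (by linarith : (0 : ℝ) ≤ inner ℝ v y)⟩
          exact (lintegral_mono_set hsub).trans hE
  have hmass : ∫⁻ x in ball xbar R ∩ {x | 0 ≤ inner ℝ u x}, ENNReal.ofReal (‖x‖ ^ θ) ≤
      ENNReal.ofReal (12 ^ θ) * ENNReal.ofReal (4 ^ (n : ℝ)) *
        (ENNReal.ofReal ((R / 4) ^ θ) * volume T) := by
    calc _ ≤ ∫⁻ x in ball xbar R, ENNReal.ofReal (‖x‖ ^ θ) := lintegral_mono_set inter_subset_left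
      _ ≤ ∫⁻ _x in ball xbar R, ENNReal.ofReal (12 ^ θ) * ENNReal.ofReal ((R / 4) ^ θ) := by
          refine setLIntegral_mono' measurableSet_ball fun x hx => ?_
          rw [← ENNReal.ofReal_mul (by positivity), ← Real.mul_rpow (by norm_num) (by positivity)]
          have := norm_le_of_mem_ball_of_norm_lt hc hx
          exact ENNReal.ofReal_le_ofReal
            (Real.rpow_le_rpow (norm_nonneg x) (by linarith) hθ)
      _ = _ := by
          rw [setLIntegral_const, volume_ball_eq_mul_volume_ball_div_four xbar
            (xbar + ((R / 2) • u + (R / 4) • v)) hR]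
          ring
  have hφm : Measurable φ := hφ.continuous.measurable
  calc _ ≤ ∫⁻ x in ball xbar R ∩ {x | 0 ≤ inner ℝ u x},
        2 ^ (q - 1) * (‖φ x - c₁‖ₑ ^ q * ENNReal.ofReal (‖x‖ ^ θ) +
          ‖c₁ - c₀‖ₑ ^ q * ENNReal.ofReal (‖x‖ ^ θ)) := by
        refine lintegral_mono fun x => ?_
        rw [← add_mul, ← mul_assoc]
        exact mul_le_mul' (enorm_sub_rpow_le_mul_add hq _ _ _) le_rfl
    _ = 2 ^ (q - 1) * ((∫⁻ x in ball xbar R ∩ {x | 0 ≤ inner ℝ u x},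
          ‖φ x - c₁‖ₑ ^ q * ENNReal.ofReal (‖x‖ ^ θ)) + ‖c₁ - c₀‖ₑ ^ q *
            ∫⁻ x in ball xbar R ∩ {x | 0 ≤ inner ℝ u x}, ENNReal.ofReal (‖x‖ ^ θ)) := by
        rw [lintegral_const_mul' _ _ (by finiteness), lintegral_add_left (by fun_prop),
          lintegral_const_mul' _ _ (by finiteness)]
    _ ≤ 2 ^ (q - 1) * (Q + ‖c₁ - c₀‖ₑ ^ q * (ENNReal.ofReal (12 ^ θ) *
          ENNReal.ofReal (4 ^ (n : ℝ)) * (ENNReal.ofReal ((R / 4) ^ θ) * volume T))) := by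
        gcongr
    _ = 2 ^ (q - 1) * (Q + ENNReal.ofReal (12 ^ θ) * ENNReal.ofReal (4 ^ (n : ℝ)) *
          (ENNReal.ofReal ((R / 4) ^ θ) * (‖c₁ - c₀‖ₑ ^ q * volume T))) := by ring
    _ ≤ 2 ^ (q - 1) * (Q + ENNReal.ofReal (12 ^ θ) * ENNReal.ofReal (4 ^ (n : ℝ)) * Q) := by
        gcongr
    _ = _ := by ring

lemma exists_norm_eq_one_inner_eq_zero {n : ℕ} (hn : 2 ≤ n) (x : En n) :
    ∃ u : En n, ‖u‖ = 1 ∧ inner ℝ u x = 0 := by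
  have hker : (innerₛₗ ℝ x : En n →ₗ[ℝ] ℝ).ker ≠ ⊥ := by
    refine LinearMap.ker_ne_bot_of_finrank_lt ?_
    rw [Module.finrank_self, finrank_euclideanSpace_fin]
    omega
  obtain ⟨u, hu, hu0⟩ := Submodule.exists_mem_ne_zero_of_ne_bot hker
  refine ⟨‖u‖⁻¹ • u, norm_smul_inv_norm hu0, ?_⟩
  rw [inner_smul_left, real_inner_comm, show inner ℝ x u = 0 from hu, mul_zero]

/-- A Poincaré inequality for the weights `‖x‖ ^ θ`, `θ ≥ 0`. -/
lemma exists_lintegral_enorm_sub_rpow_le_of_radial {n : ℕ} (hn : 2 ≤ n) {q : ℝ} (hq : 1 < q)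
    {θ : ℝ} (hθ : 0 ≤ θ) : ∃ C : ℝ≥0∞, C ≠ ⊤ ∧ ∀ (xbar : En n) (R : ℝ), 0 < R →
      ∀ φ : En n → ℝ, ContDiff ℝ 1 φ →
      ∃ a : ℝ, ∫⁻ x in ball xbar R, ‖φ x - a‖ₑ ^ q * ENNReal.ofReal (‖x‖ ^ θ) ≤
        C * ENNReal.ofReal (R ^ q) *
          ∫⁻ x in ball xbar R, ‖fderiv ℝ φ x‖ₑ ^ q * ENNReal.ofReal (‖x‖ ^ θ) := by
  have h0 : 0 < q := by linarith
  have hq1 : 0 < q - 1 := by linarith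
  set C₁ : ℝ≥0∞ := ENNReal.ofReal (2 ^ q) * (ENNReal.ofReal (3 ^ θ) * ENNReal.ofReal (2 ^ (n : ℝ)))
  set C₂ : ℝ≥0∞ := 2 * (2 ^ (q - 1) * (1 + ENNReal.ofReal (12 ^ θ) * ENNReal.ofReal (4 ^ (n : ℝ))) *
    (ENNReal.ofReal (2 ^ q) * (ENNReal.ofReal (25 ^ θ) * (ENNReal.ofReal (2 ^ (n : ℝ)) *
      ENNReal.ofReal (4 ^ (n : ℝ)))))) with hC₂
  refine ⟨C₁ + C₂, by finiteness, fun xbar R hR φ hφ => ?_⟩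
  have h2R : ENNReal.ofReal (2 * R) ^ q = ENNReal.ofReal (2 ^ q) * ENNReal.ofReal (R ^ q) := by
    rw [ENNReal.ofReal_rpow_of_pos (by positivity), Real.mul_rpow (by norm_num) hR.le,
      ENNReal.ofReal_mul (by positivity)]
  rcases le_or_gt (2 * R) ‖xbar‖ with hc | hc
  · refine ⟨(∫ y in ball xbar R, φ y) / (volume (ball xbar R)).toReal, ?_⟩
    calc _ ≤ C₁ * ENNReal.ofReal (R ^ q) *
          ∫⁻ x in ball xbar R, ‖fderiv ℝ φ x‖ₑ ^ q * ENNReal.ofReal (‖x‖ ^ θ) := by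
          refine (lintegral_enorm_sub_mean_rpow_le_of_volume_le hq (K := ENNReal.ofReal (3 ^ θ))
            (M := 1) (measurable_ofReal_norm_rpow n θ) measurableSet_ball measurableSet_ball
            subset_rfl subset_rfl (measure_ball_pos volume _ hR).ne' (one_mul _).ge
            (fun x hx y hy t ht => ?_) hφ).trans_eq (by rw [h2R]; ring)
          refine ofReal_norm_rpow_le hθ (by norm_num) ?_
          have hz := (convex_ball xbar R).add_smul_sub_mem hx hy ⟨ht.1.le, ht.2⟩
          have h1 := norm_le_norm_add_norm_sub' x xbar
          have h2 := norm_le_norm_add_norm_sub' xbar (x + t • (y - x))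
          rw [mem_ball_iff_norm] at hx hz
          rw [norm_sub_rev] at hz
          linarith
      _ ≤ _ := by gcongr; exact le_self_add
  · obtain ⟨u, hu, hux⟩ := exists_norm_eq_one_inner_eq_zero hn xbar
    obtain ⟨v, hv, huv, hvx⟩ : ∃ v : En n, ‖v‖ = 1 ∧ inner ℝ u v = 0 ∧ 0 ≤ inner ℝ v xbar := by
      obtain ⟨v, hv, hvu⟩ := exists_norm_eq_one_inner_eq_zero hn u
      rw [real_inner_comm] at hvu
      rcases le_total 0 (inner ℝ v xbar) with h | h
      · exact ⟨v, hv, hvu, h⟩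
      · exact ⟨-v, by rwa [norm_neg], by rw [inner_neg_right, hvu, neg_zero],
          by rw [inner_neg_left]; linarith⟩
    refine ⟨(∫ y in ball (xbar + (R / 2) • v) (R / 4), φ y) /
      (volume (ball (xbar + (R / 2) • v) (R / 4))).toReal, ?_⟩
    have hpos := lintegral_halfSpace_enorm_sub_rpow_le hq hθ hR hc hu hv huv hux hvx hφ
    have hneg := lintegral_halfSpace_enorm_sub_rpow_le hq hθ hR hc (u := -u) (by rwa [norm_neg]) hv
      (by rw [inner_neg_left, huv, neg_zero]) (by rw [inner_neg_left, hux, neg_zero]) hvx hφ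
    have hsub : ball xbar R ⊆ (ball xbar R ∩ {x | 0 ≤ inner ℝ u x}) ∪
        (ball xbar R ∩ {x | 0 ≤ inner ℝ (-u) x}) := by
      intro x hx
      rcases le_total 0 (inner ℝ u x) with h | h
      · exact Or.inl ⟨hx, h⟩
      · refine Or.inr ⟨hx, ?_⟩
        simpa [inner_neg_left] using h
    refine (lintegral_mono_set hsub).trans ((lintegral_union_le _ _ _).trans
      ((add_le_add hpos hneg).trans ?_))
    calc _ = C₂ * ENNReal.ofReal (R ^ q) *
          ∫⁻ x in ball xbar R, ‖fderiv ℝ φ x‖ₑ ^ q * ENNReal.ofReal (‖x‖ ^ θ) := by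
          rw [hC₂, h2R]; ring
      _ ≤ _ := by gcongr; exact le_add_self

lemma setLIntegral_muW {n : ℕ} (θ1 θ2 : ℝ) {s : Set (En n)} (hs : MeasurableSet s)
    {f : En n → ℝ≥0∞} (hf : Measurable f) :
    ∫⁻ x in s, f x ∂(muW n θ1 θ2) = ∫⁻ x in s, f x * ENNReal.ofReal (weight n θ1 θ2 x) := by
  rw [muW, setLIntegral_withDensity_eq_setLIntegral_mul _ (measurable_weight_s3 n θ1 θ2).ennreal_ofReal
    hf hs]
  simp only [Pi.mul_apply, mul_comm]

lemma muW_ball_lt_top {n : ℕ} (hn : 2 ≤ n) {θ1 θ2 : ℝ} (h : (θ1, θ2) ∈ setA n ∪ setB n)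
    (xbar : En n) {R : ℝ} (hR : 0 < R) : muW n θ1 θ2 (ball xbar R) < ⊤ := by
  obtain ⟨K, hK, hball⟩ := exists_lintegral_ball_weight_le hn h
  rw [muW, withDensity_apply _ measurableSet_ball]
  exact (hball xbar R hR).trans_lt (by finiteness)

lemma norm_gradient_eq_norm_fderiv {n : ℕ} (φ : En n → ℝ) (x : En n) :
    ‖gradient φ x‖ = ‖fderiv ℝ φ x‖ :=
  LinearIsometryEquiv.norm_map _ _

/-- The Poincaré inequality around some constant, for all admissible weights. -/
lemma exists_lintegral_enorm_sub_rpow_mul_weight_le {n : ℕ} (hn : 2 ≤ n) {q θ1 θ2 : ℝ} (hq : 1 < q)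
    (hθ : (θ1, θ2) ∈ (setA n ∪ setB n) ∩ (setC n q ∪ setD n q) ∨ (θ1 = 0 ∧ -(n : ℝ) < θ2)) :
    ∃ C : ℝ≥0∞, C ≠ ⊤ ∧ ∀ (xbar : En n) (R : ℝ), 0 < R → ∀ φ : En n → ℝ, ContDiff ℝ 1 φ →
      ∃ a : ℝ, ∫⁻ x in ball xbar R, ‖φ x - a‖ₑ ^ q * ENNReal.ofReal (weight n θ1 θ2 x) ≤
        C * ENNReal.ofReal (R ^ q) *
          ∫⁻ x in ball xbar R, ‖fderiv ℝ φ x‖ₑ ^ q * ENNReal.ofReal (weight n θ1 θ2 x) := by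
  have hn' : (2 : ℝ) ≤ n := by exact_mod_cast hn
  have hq1 : 0 < q - 1 := by linarith
  by_cases hrad : θ1 = 0 ∧ 0 ≤ θ2
  · obtain ⟨rfl, h⟩ := hrad
    simpa only [weight, Real.rpow_zero, one_mul] using
      exists_lintegral_enorm_sub_rpow_le_of_radial hn hq h
  have hmem : (θ1, θ2) ∈ (setA n ∪ setB n) ∩ (setC n q ∪ setD n q) := by
    rcases hθ with h | ⟨rfl, h⟩
    · exact h
    have h2 : θ2 < 0 := by
      by_contra h2
      exact hrad ⟨rfl, not_lt.1 h2⟩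
    refine ⟨Or.inr ⟨?_, h2, ?_⟩, Or.inl ⟨?_, h2.le⟩⟩
    · show -((n : ℝ) - 1) < 0
      linarith
    · show -(n : ℝ) < 0 + θ2
      linarith
    · exact mul_pos (by linarith) hq1
  obtain ⟨K, hK, hA⟩ := exists_muckenhoupt_weight hn hq hmem.1 hmem.2
  have hV : volume (ball (0 : En n) 1) ^ q ≠ 0 :=
    (ENNReal.rpow_pos (measure_ball_pos volume _ one_pos) measure_ball_lt_top.ne).ne'
  refine ⟨K * ENNReal.ofReal (2 ^ q * 4 ^ ((n : ℝ) * q)) * (volume (ball (0 : En n) 1) ^ q)⁻¹,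
    by finiteness, fun xbar R hR φ hφ => ?_⟩
  exact exists_lintegral_enorm_sub_rpow_le_of_muckenhoupt hq
    (measurable_weight_s3 n θ1 θ2).ennreal_ofReal (measurable_weight_s3 n _ _).ennreal_ofReal
    (ae_one_le_weight_mul_weight hn hq θ1 θ2) hA xbar hR hφ

/-- anisotropic weighted Poincaré inequality. -/
theorem weighted_poincare (n : ℕ) (hn : 2 ≤ n) (q θ1 θ2 : ℝ) (hq : 1 < q)
    (hθ : (θ1, θ2) ∈ (setA n ∪ setB n) ∩ (setC n q ∪ setD n q) ∨
      (θ1 = 0 ∧ -(n : ℝ) < θ2)) :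
    ∃ C : ℝ, 0 < C ∧ ∀ (xbar : En n) (R : ℝ), 0 < R → ∀ φ : En n → ℝ, ContDiff ℝ 1 φ →
      ∫⁻ x in ball xbar R,
          ENNReal.ofReal
            (|φ x - (∫ y in ball xbar R, φ y ∂(muW n θ1 θ2)) /
                (muW n θ1 θ2 (ball xbar R)).toReal| ^ q) ∂(muW n θ1 θ2)
      ≤ ENNReal.ofReal (C * R ^ q) *
          ∫⁻ x in ball xbar R, ENNReal.ofReal (‖gradient φ x‖ ^ q) ∂(muW n θ1 θ2) := by
  have h0 : 0 < q := by linarith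
  have hn' : (2 : ℝ) ≤ n := by exact_mod_cast hn
  have hAB : (θ1, θ2) ∈ setA n ∪ setB n := by
    rcases hθ with h | ⟨rfl, h⟩
    · exact h.1
    have h1 : -((n : ℝ) - 1) < 0 := by linarith
    rcases le_or_gt 0 θ2 with h2 | h2
    · exact Or.inl ⟨h1, h2⟩
    · exact Or.inr ⟨h1, h2, by simpa using h⟩
  obtain ⟨C, hC, hbound⟩ := exists_lintegral_enorm_sub_rpow_mul_weight_le hn hq hθ
  have hC' : 2 ^ q * C ≠ ⊤ := by finiteness
  refine ⟨(2 ^ q * C).toReal + 1, by positivity, fun xbar R hR φ hφ => ?_⟩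
  have hfin := muW_ball_lt_top hn hAB xbar hR
  have : IsFiniteMeasure ((muW n θ1 θ2).restrict (ball xbar R)) := ⟨by simpa using hfin⟩
  obtain ⟨a, ha⟩ := hbound xbar R hR φ hφ
  have hmean := lintegral_enorm_sub_mean_rpow_le hq
    (integrableOn_ball_of_continuous hφ.continuous hfin.ne) a
  rw [Measure.restrict_apply_univ] at hmean
  have hφm : Measurable φ := hφ.continuous.measurable
  have hdm : Measurable fun x => ‖fderiv ℝ φ x‖ₑ :=
    (hφ.continuous_fderiv one_ne_zero).measurable.enorm
  rw [← setLIntegral_muW θ1 θ2 measurableSet_ball (by fun_prop),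
    ← setLIntegral_muW θ1 θ2 measurableSet_ball (hdm.pow_const q)] at ha
  simp only [norm_gradient_eq_norm_fderiv, ← ENNReal.ofReal_rpow_of_nonneg (abs_nonneg _) h0.le,
    ← ENNReal.ofReal_rpow_of_nonneg (norm_nonneg _) h0.le, ofReal_norm, ← Real.enorm_eq_ofReal_abs]
  calc _ ≤ 2 ^ q * ∫⁻ x in ball xbar R, ‖φ x - a‖ₑ ^ q ∂(muW n θ1 θ2) := hmean
    _ ≤ 2 ^ q * (C * ENNReal.ofReal (R ^ q) *
          ∫⁻ x in ball xbar R, ‖fderiv ℝ φ x‖ₑ ^ q ∂(muW n θ1 θ2)) := by gcongr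
    _ = 2 ^ q * C * ENNReal.ofReal (R ^ q) *
          ∫⁻ x in ball xbar R, ‖fderiv ℝ φ x‖ₑ ^ q ∂(muW n θ1 θ2) := by ring
    _ ≤ _ := by
        rw [ENNReal.ofReal_mul (by positivity)]
        gcongr
        rw [← ENNReal.ofReal_toReal hC']
        exact ENNReal.ofReal_le_ofReal (by simp)
end
end
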